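/- arXiv:0906.0045 — 9 statements merged into one kernel-verified Lean document; each statement's English description precedes it below -/
import Mathlib

section
/- For every sequence x = (x_k)_{k≥1} of points of the unit circle 𝕋 = ℝ/ℤ, the inequality D_n(x) ≥ φ_n holds for infinitely many integers n ≥ 1. -/
/-- The covering radius `D_n(x)` of the first `n` terms of a sequence `x` in the
unit circle `𝕋 = ℝ/ℤ`: the maximal distance from a point of the circle to the
set `{x_1, …, x_n}`. -/
noncomputable def covRad (x : ℕ → AddCircle (1 : ℝ)) (n : ℕ) : ℝ :=
  ⨆ t : AddCircle (1 : ℝ), sInf ((fun k => dist t (x k)) '' Set.Icc 1 n)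

/-- `φ_n = (ln(n+1) − ln n)/(2 ln 2)`. -/
noncomputable def phi (n : ℕ) : ℝ :=
  (Real.log (n + 1) - Real.log n) / (2 * Real.log 2)

open Metric

abbrev Arc := AddCircle (1 : ℝ) × ℝ

/-- disjointness of the open arcs -/
def ArcDisj (p q : Arc) : Prop := Disjoint (ball p.1 p.2) (ball q.1 q.2)

theorem ArcDisj.symm' {p q : Arc} (h : ArcDisj p q) : ArcDisj q p := Disjoint.symm h

theorem le_covRad (x : ℕ → AddCircle (1 : ℝ)) (m : ℕ) (hm : 1 ≤ m) (c : AddCircle (1 : ℝ)) (h : ℝ)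
    (hc : ∀ k ∈ Set.Icc 1 m, h ≤ dist c (x k)) : h ≤ covRad x m := by
  unfold covRad
  have hb : BddAbove (Set.range fun t : AddCircle (1 : ℝ) =>
      sInf ((fun k => dist t (x k)) '' Set.Icc 1 m)) := by
    refine ⟨1 / 2, ?_⟩
    rintro _ ⟨t, rfl⟩
    refine (csInf_le (s := (fun k => dist t (x k)) '' Set.Icc 1 m) (a := dist t (x 1)) ⟨0, ?_⟩ ⟨1, ⟨le_rfl, hm⟩, rfl⟩).trans ?_
    · rintro _ ⟨k, _, rfl⟩
      exact dist_nonneg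
    · have := AddCircle.norm_le_half_period (1 : ℝ) (x := t - x 1) one_ne_zero
      simpa [dist_eq_norm] using this
  refine le_trans ?_ (le_ciSup hb c)
  apply le_csInf
  · exact ⟨_, ⟨1, ⟨le_rfl, hm⟩, rfl⟩⟩
  · rintro _ ⟨k, hk, rfl⟩
    exact hc k hk

theorem norm_coe_half (a : ℝ) (h0 : 0 ≤ a) (h : a ≤ 1 / 2) : ‖(a : AddCircle (1 : ℝ))‖ = a := by
  have := (AddCircle.norm_coe_eq_abs_iff (1 : ℝ) (x := a) one_ne_zero).2
    (by rw [abs_of_nonneg h0]; simpa using h)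
  rw [this, abs_of_nonneg h0]

theorem norm_coe_le (a : ℝ) : ‖(a : AddCircle (1 : ℝ))‖ ≤ |a| := by
  have := AddCircle.norm_eq (1 : ℝ) (x := a)
  simp at this
  rw [this]
  simpa using round_le a 0

theorem exists_rep (z : AddCircle (1 : ℝ)) : ∃ s : ℝ, (s : AddCircle (1 : ℝ)) = z ∧ |s| = ‖z‖ := by
  induction z using QuotientAddGroup.induction_on with
  | H a =>
    refine ⟨a - round a, ?_, ?_⟩
    · rw [AddCircle.coe_sub]
      have : ((round a : ℝ) : AddCircle (1 : ℝ)) = 0 := by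
        rw [AddCircle.coe_eq_zero_iff]
        exact ⟨round a, by simp⟩
      rw [this, sub_zero]
    · have := AddCircle.norm_eq (1 : ℝ) (x := a)
      simp at this
      exact this.symm

theorem sum_le (x : ℕ → AddCircle (1 : ℝ)) (k : ℕ) : ∀ (m : ℕ) (L : List Arc), 1 ≤ m →
    L.length = k → L.Pairwise ArcDisj →
    (∀ p ∈ L, ∀ j ∈ Set.Icc 1 m, p.2 ≤ dist p.1 (x j)) →
    (L.map Prod.snd).sum ≤ ∑ j ∈ Finset.range k, covRad x (m + j) := by
  induction k with
  | zero =>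
    intro m L _ hl _ _
    have : L = [] := List.length_eq_zero_iff.1 hl
    simp [this]
  | succ k ih =>
    intro m L hm hl hp hL
    have key : ∃ p L', L.Perm (p :: L') ∧ ∀ q ∈ L', q.2 ≤ dist q.1 (x (m + 1)) := by
      by_cases hex : ∃ p ∈ L, dist p.1 (x (m + 1)) < p.2
      · obtain ⟨p, hpL, hd⟩ := hex
        obtain ⟨L1, L2, rfl⟩ := List.append_of_mem hpL
        refine ⟨p, L1 ++ L2, List.perm_middle, ?_⟩
        have hp' := (List.perm_middle.pairwise_iff (fun h => ArcDisj.symm' h)).1 hp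
        intro q hq
        have hdis : ArcDisj p q := (List.pairwise_cons.1 hp').1 q hq
        by_contra hcon
        push Not at hcon
        exact (Set.disjoint_left.1 hdis : ∀ ⦃a⦄, _) (show x (m + 1) ∈ _ by rwa [mem_ball, dist_comm])
          (by rwa [mem_ball, dist_comm])
      · push Not at hex
        cases L with
        | nil => simp at hl
        | cons p L' => exact ⟨p, L', List.Perm.refl _, fun q hq => hex q (List.mem_cons_of_mem _ hq)⟩
    obtain ⟨p, L', hperm, hq⟩ := key
    have hp' := (hperm.pairwise_iff (fun h => ArcDisj.symm' h)).1 hp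
    have h1 := ih (m + 1) L' (by omega) (by have := hperm.length_eq; simp at this; omega)
      (List.pairwise_cons.1 hp').2 (by
        intro q hqm j hj
        rcases Nat.lt_or_ge m j with hlt | hge
        · have : j = m + 1 := le_antisymm hj.2 hlt
          rw [this]; exact hq q hqm
        · exact hL q (hperm.mem_iff.2 (List.mem_cons_of_mem _ hqm)) j ⟨hj.1, hge⟩)
    have h2 := le_covRad x m hm p.1 p.2 (hL p (hperm.mem_iff.2 List.mem_cons_self))
    rw [(hperm.map Prod.snd).sum_eq, Finset.sum_range_succ']
    simp only [List.map_cons, List.sum_cons, add_zero]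
    have h3 : ∑ j ∈ Finset.range k, covRad x (m + 1 + j)
        = ∑ j ∈ Finset.range k, covRad x (m + (j + 1)) :=
      Finset.sum_congr rfl fun j _ => by congr 1; omega
    linarith

theorem exists_arcs (x : ℕ → AddCircle (1 : ℝ)) (n : ℕ) (hn : 1 ≤ n) : ∃ L : List Arc,
    L.length = n ∧ L.Pairwise ArcDisj ∧ (∀ p ∈ L, p.2 ≤ 1 / 2) ∧
    (∀ p ∈ L, ∀ j ∈ Set.Icc 1 n, p.2 ≤ dist p.1 (x j)) ∧
    (L.map Prod.snd).sum = 1 / 2 := by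
  induction n, hn using Nat.le_induction with
  | base =>
    refine ⟨[(x 1 + ((1 / 2 : ℝ) : AddCircle (1 : ℝ)), 1 / 2)], rfl, by simp, by simp, ?_, by simp⟩
    intro p hp j hj
    have hj' : j = 1 := le_antisymm hj.2 hj.1
    rw [List.mem_singleton] at hp
    subst hp hj'
    rw [dist_eq_norm, add_sub_cancel_left, norm_coe_half _ (by norm_num) le_rfl]
  | succ m hm ih =>
    obtain ⟨L, hl, hp, hh, hL, hs⟩ := ih
    by_cases hex : ∃ p ∈ L, dist (x (m + 1)) p.1 < p.2
    · obtain ⟨⟨c, h⟩, hpL, hd⟩ := hex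
      obtain ⟨L1, L2, hLL⟩ := List.append_of_mem hpL
      have hperm : L.Perm ((c, h) :: (L1 ++ L2)) := hLL ▸ List.perm_middle
      generalize L1 ++ L2 = L' at hperm
      have hp' := List.pairwise_cons.1 ((hperm.pairwise_iff (fun h => ArcDisj.symm' h)).1 hp)
      have hsub : ∀ q ∈ L', q ∈ L := fun q hq => hperm.mem_iff.2 (List.mem_cons_of_mem _ hq)
      have hh0 : h ≤ 1 / 2 := hh _ hpL
      have hc0 := hL _ hpL
      simp only at hd hc0
      obtain ⟨s, hsy, hsn⟩ := exists_rep (x (m + 1) - c)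
      rw [dist_eq_norm, ← hsn, abs_lt] at hd
      have hy : x (m + 1) = c + (s : AddCircle (1 : ℝ)) := by rw [hsy]; abel
      -- general sub-arc facts
      have hd1 : dist (c + (((s - h) / 2 : ℝ) : AddCircle (1 : ℝ))) c ≤ (h - s) / 2 := by
        rw [dist_eq_norm, add_sub_cancel_left]
        refine (norm_coe_le _).trans ?_
        rw [abs_of_nonpos (by linarith)]; linarith
      have hd2 : dist (c + (((s + h) / 2 : ℝ) : AddCircle (1 : ℝ))) c ≤ (h + s) / 2 := by
        rw [dist_eq_norm, add_sub_cancel_left]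
        refine (norm_coe_le _).trans ?_
        rw [abs_of_nonneg (by linarith)]; linarith
      have hy1 : dist (c + (((s - h) / 2 : ℝ) : AddCircle (1 : ℝ))) (x (m + 1)) = (h + s) / 2 := by
        rw [hy, dist_comm, dist_eq_norm, add_sub_add_left_eq_sub, ← AddCircle.coe_sub,
          norm_coe_half] <;> linarith
      have hy2 : dist (c + (((s + h) / 2 : ℝ) : AddCircle (1 : ℝ))) (x (m + 1)) = (h - s) / 2 := by
        rw [hy, dist_eq_norm, add_sub_add_left_eq_sub, ← AddCircle.coe_sub,
          norm_coe_half] <;> linarith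
      have h12 : dist (c + (((s - h) / 2 : ℝ) : AddCircle (1 : ℝ)))
          (c + (((s + h) / 2 : ℝ) : AddCircle (1 : ℝ))) = h := by
        rw [dist_comm, dist_eq_norm, add_sub_add_left_eq_sub, ← AddCircle.coe_sub,
          norm_coe_half] <;> linarith
      generalize c + (((s - h) / 2 : ℝ) : AddCircle (1 : ℝ)) = c1 at *
      generalize c + (((s + h) / 2 : ℝ) : AddCircle (1 : ℝ)) = c2 at *
      have hsub1 : ball c1 ((h + s) / 2) ⊆ ball c h := ball_subset_ball' (by linarith)
      have hsub2 : ball c2 ((h - s) / 2) ⊆ ball c h := ball_subset_ball' (by linarith)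
      refine ⟨(c1, (h + s) / 2) :: (c2, (h - s) / 2) :: L', ?_, ?_, ?_, ?_, ?_⟩
      · have := hperm.length_eq
        simp at this ⊢; omega
      · refine List.pairwise_cons.2 ⟨?_, List.pairwise_cons.2 ⟨?_, hp'.2⟩⟩
        · intro q hq
          rcases List.mem_cons.1 hq with rfl | hq
          · exact ball_disjoint_ball (by rw [h12]; linarith)
          · exact Disjoint.mono_left hsub1 (hp'.1 q hq)
        · intro q hq
          exact Disjoint.mono_left hsub2 (hp'.1 q hq)
      · intro q hq
        rcases List.mem_cons.1 hq with rfl | hq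
        · simp only; linarith
        rcases List.mem_cons.1 hq with rfl | hq
        · simp only; linarith
        exact hh q (hsub q hq)
      · have hnot : ∀ q ∈ L', q.2 ≤ dist q.1 (x (m + 1)) := by
          intro q hq
          by_contra hcon
          push Not at hcon
          exact (Set.disjoint_left.1 (hp'.1 q hq) : ∀ ⦃a⦄, _)
            (show x (m + 1) ∈ _ by rw [mem_ball, dist_eq_norm, ← hsn]; exact abs_lt.2 hd)
            (by rwa [mem_ball, dist_comm])
        intro q hq j hj
        rcases Nat.lt_or_ge m j with hlt | hge
        · have : j = m + 1 := le_antisymm hj.2 hlt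
          subst this
          rcases List.mem_cons.1 hq with rfl | hq
          · exact hy1.ge
          rcases List.mem_cons.1 hq with rfl | hq
          · exact hy2.ge
          exact hnot q hq
        · have hcj := hc0 j ⟨hj.1, hge⟩
          rcases List.mem_cons.1 hq with rfl | hq
          · have := dist_triangle_left c (x j) c1
            simp only; linarith
          rcases List.mem_cons.1 hq with rfl | hq
          · have := dist_triangle_left c (x j) c2
            simp only; linarith
          exact hL q (hsub q hq) j ⟨hj.1, hge⟩
      · rw [(hperm.map Prod.snd).sum_eq] at hs
        simp only [List.map_cons, List.sum_cons] at hs ⊢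
        linarith
    · push Not at hex
      refine ⟨(0, 0) :: L, by simp [hl], ?_, ?_, ?_, by simpa using hs⟩
      · refine List.pairwise_cons.2 ⟨fun q _ => ?_, hp⟩
        simp [ArcDisj]
      · intro q hq
        rcases List.mem_cons.1 hq with rfl | hq
        · norm_num
        · exact hh q hq
      · intro q hq j hj
        rcases List.mem_cons.1 hq with rfl | hq
        · exact dist_nonneg
        · rcases Nat.lt_or_ge m j with hlt | hge
          · have : j = m + 1 := le_antisymm hj.2 hlt
            rw [this, dist_comm]; exact hex q hq
          · exact hL q hq j ⟨hj.1, hge⟩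

theorem sum_phi (n : ℕ) (k : ℕ) : ∑ j ∈ Finset.range k, phi (n + j)
    = (Real.log ((n + k : ℕ) : ℝ) - Real.log n) / (2 * Real.log 2) := by
  induction k with
  | zero => simp
  | succ k ih =>
    rw [Finset.sum_range_succ, ih, phi, ← add_div]
    congr 1
    push_cast
    rw [← add_assoc]
    ring

/-- For any sequence `x` in the unit circle, the inequality `D_n(x) ≥ φ_n` holds
for infinitely many integers `n ≥ 1`. -/
theorem covRad_ge_phi_frequently (x : ℕ → AddCircle (1 : ℝ)) :
    {n : ℕ | 1 ≤ n ∧ phi n ≤ covRad x n}.Infinite := by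
  intro hfin
  obtain ⟨N, hN⟩ := hfin.bddAbove
  obtain ⟨L, hl, hp, _, hL, hs⟩ := exists_arcs x (N + 1) (by omega)
  have h1 := sum_le x (N + 1) (N + 1) L (by omega) hl hp hL
  have h2 : ∑ j ∈ Finset.range (N + 1), covRad x (N + 1 + j)
      < ∑ j ∈ Finset.range (N + 1), phi (N + 1 + j) := by
    apply Finset.sum_lt_sum_of_nonempty (by simp)
    intro j _
    by_contra hcon
    push Not at hcon
    have := hN (show N + 1 + j ∈ _ from ⟨by omega, hcon⟩)
    omega
  have h3 : (((N + 1 + (N + 1) : ℕ)) : ℝ) = 2 * ((N + 1 : ℕ) : ℝ) := by push_cast; ring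
  have hlog : 0 < Real.log 2 := Real.log_pos (by norm_num)
  rw [sum_phi, h3, Real.log_mul (by norm_num) (by positivity), add_sub_cancel_right] at h2
  have h4 : Real.log 2 / (2 * Real.log 2) = 1 / 2 := by field_simp
  linarith
end

section
/- For every sequence x = (x_k)_{k≥1} of points of the unit circle 𝕋 = ℝ/ℤ, one has limsup_{n→∞} n · D_n(x) ≥ 1/(2 ln 2). -/
theorem cr_abstract {α : Type*} [DecidableEq α] (P : Finset α) (n : ℕ) (hP : P.card ≤ n)
    (A : ℕ → α → Prop) (l : α → ℝ) (d : ℕ → ℝ) (hd : ∀ k, 0 ≤ d k)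
    (h0 : ∀ p ∈ P, A 0 p)
    (h1 : ∀ k, ∀ p ∈ P, ∀ q ∈ P, A k p → A k q → ¬ A (k+1) p → ¬ A (k+1) q → p = q)
    (h2 : ∀ k, ∀ p ∈ P, A k p → l p ≤ d k) :
    ∑ p ∈ P, l p ≤ ∑ k ∈ Finset.range n, d k := by
  have key : ∀ k ≤ n, ∃ H ⊆ P, H.card ≤ n - k ∧ (∀ p ∈ H, A k p) ∧
      ∑ p ∈ P, l p ≤ ∑ j ∈ Finset.range k, d j + ∑ p ∈ H, l p := by
    intro k
    induction k with
    | zero => intro _; exact ⟨P, subset_rfl, by simpa using hP, h0, by simp⟩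
    | succ k ih =>
      intro hk
      obtain ⟨H, hHP, hc, hA, hs⟩ := ih (by omega)
      rcases H.eq_empty_or_nonempty with rfl | hne
      · refine ⟨∅, by simp, by simp, by simp, ?_⟩
        rw [Finset.sum_range_succ]
        have := hd k
        simp at hs ⊢
        linarith
      · have : ∃ e ∈ H, ∀ p ∈ H, p ≠ e → A (k+1) p := by
          by_cases hx : ∃ e ∈ H, ¬ A (k+1) e
          · obtain ⟨e, he, hne⟩ := hx
            refine ⟨e, he, fun p hp hpe => ?_⟩
            by_contra hcon
            exact hpe (h1 k p (hHP hp) e (hHP he) (hA p hp) (hA e he) hcon hne)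
          · push Not at hx
            obtain ⟨e, he⟩ := hne
            exact ⟨e, he, fun p hp _ => hx p hp⟩
        obtain ⟨e, he, hall⟩ := this
        refine ⟨H.erase e, (Finset.erase_subset _ _).trans hHP, ?_, ?_, ?_⟩
        · rw [Finset.card_erase_of_mem he]; omega
        · intro p hp
          rw [Finset.mem_erase] at hp
          exact hall p hp.2 hp.1
        · rw [Finset.sum_range_succ]
          have a := Finset.add_sum_erase H l he
          have b := h2 k e (hHP he) (hA e he)
          linarith
  obtain ⟨H, _, hc, _, hs⟩ := key n le_rfl
  have : H = ∅ := by
    rw [← Finset.card_eq_zero]; omega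
  subst this
  simpa using hs

theorem cr_le (x : ℕ → AddCircle (1 : ℝ)) (m : ℕ) (hm : 1 ≤ m) (t : AddCircle (1 : ℝ)) (g : ℝ)
    (h : ∀ i ∈ Set.Icc 1 m, g ≤ dist t (x i)) : g ≤ covRad x m := by
  unfold covRad
  have hb : BddAbove (Set.range fun t : AddCircle (1 : ℝ) =>
      sInf ((fun k => dist t (x k)) '' Set.Icc 1 m)) := by
    refine ⟨1/2, ?_⟩
    rintro _ ⟨s, rfl⟩
    have h1m : (1:ℕ) ∈ Set.Icc 1 m := Set.mem_Icc.2 ⟨le_rfl, hm⟩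
    have hmem := Set.mem_image_of_mem (fun k => dist s (x k)) h1m
    refine (csInf_le ⟨0, ?_⟩ hmem).trans ?_
    · rintro _ ⟨i, _, rfl⟩; exact dist_nonneg
    · have := AddCircle.norm_le_half_period (1:ℝ) (x := s - x 1) one_ne_zero
      simpa [dist_eq_norm] using this
  refine le_trans ?_ (le_ciSup hb t)
  apply le_csInf
  · exact ⟨_, 1, ⟨le_rfl, hm⟩, rfl⟩
  · rintro _ ⟨i, hi, rfl⟩; exact h i hi

noncomputable def crGap (P : Finset (AddCircle (1 : ℝ))) (p : AddCircle (1 : ℝ)) : ℝ :=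
  sInf {r : ℝ | 0 < r ∧ (r : AddCircle (1 : ℝ)) + p ∈ P}

theorem crGap_bdd (P : Finset (AddCircle (1 : ℝ))) (p : AddCircle (1 : ℝ)) :
    BddBelow {r : ℝ | 0 < r ∧ (r : AddCircle (1 : ℝ)) + p ∈ P} :=
  ⟨0, fun _ h => h.1.le⟩

theorem crGap_notMem (P : Finset (AddCircle (1 : ℝ))) (p : AddCircle (1 : ℝ)) (r : ℝ)
    (h0 : 0 < r) (h1 : r < crGap P p) : (r : AddCircle (1 : ℝ)) + p ∉ P := fun h =>
  absurd (csInf_le (crGap_bdd P p) ⟨h0, h⟩) (not_le.2 h1)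

theorem crGap_disj (P : Finset (AddCircle (1 : ℝ))) (p q : AddCircle (1 : ℝ)) (hp : p ∈ P)
    (a b : ℝ) (hb : b < crGap P q) (ha : 0 < a) (hab : a ≤ b)
    (h : (a : AddCircle (1 : ℝ)) + p = (b : AddCircle (1 : ℝ)) + q) : p = q := by
  rcases hab.eq_or_lt with rfl | hlt
  · exact add_left_cancel h
  · exfalso
    apply crGap_notMem P q (b - a) (by linarith) (by linarith)
    have : ((b - a : ℝ) : AddCircle (1 : ℝ)) + q = p := by
      rw [AddCircle.coe_sub, sub_add_eq_add_sub, ← h]; abel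
    rwa [this]

theorem crGap_sum (P : Finset (AddCircle (1 : ℝ))) (hP : P.Nonempty) :
    1 ≤ ∑ p ∈ P, crGap P p := by
  haveI : Fact ((0:ℝ) < 1) := ⟨one_pos⟩
  have hg0 : ∀ p, 0 ≤ crGap P p := fun p => Real.sInf_nonneg fun r h => h.1.le
  have cover : (Set.univ : Set (AddCircle (1 : ℝ))) ⊆
      ⋃ p ∈ P, Metric.closedBall (((crGap P p / 2 : ℝ) : AddCircle (1 : ℝ)) + p) (crGap P p / 2) := by
    intro t _
    obtain ⟨p, hp, hmin⟩ := Finset.exists_min_image P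
      (fun p => ((AddCircle.equivIco (1:ℝ) 0 (t - p) : Set.Ico (0:ℝ) (0+1)) : ℝ)) hP
    set a : ℝ := ((AddCircle.equivIco (1:ℝ) 0 (t - p) : Set.Ico (0:ℝ) (0+1)) : ℝ) with ha
    have ha0 : 0 ≤ a := (AddCircle.equivIco (1:ℝ) 0 (t - p)).2.1
    have ha1 : a < 0 + 1 := (AddCircle.equivIco (1:ℝ) 0 (t - p)).2.2
    have hac : (a : AddCircle (1 : ℝ)) = t - p := (AddCircle.equivIco (1:ℝ) 0).symm_apply_apply (t - p)
    have hag : a ≤ crGap P p := by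
      apply le_csInf
      · exact ⟨1, one_pos, by rw [AddCircle.coe_period, zero_add]; exact hp⟩
      · rintro r ⟨hr, hq⟩
        by_contra hlt
        push Not at hlt
        have h1 := hmin _ hq
        have h2 : t - ((r : AddCircle (1 : ℝ)) + p) = ((a - r : ℝ) : AddCircle (1 : ℝ)) := by
          rw [AddCircle.coe_sub, hac]; abel
        simp only [h2] at h1
        have h3 : ((AddCircle.equivIco (1:ℝ) 0 ((a - r : ℝ) : AddCircle (1 : ℝ)) :
          Set.Ico (0:ℝ) (0+1)) : ℝ) = a - r := by
          rw [AddCircle.equivIco_coe_eq (x := a - r) ⟨by linarith, by linarith⟩]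
        rw [h3] at h1
        linarith
    refine Set.mem_iUnion₂.2 ⟨p, hp, ?_⟩
    rw [Metric.mem_closedBall, dist_eq_norm]
    have : t - (((crGap P p / 2 : ℝ) : AddCircle (1 : ℝ)) + p)
        = ((a - crGap P p / 2 : ℝ) : AddCircle (1 : ℝ)) := by
      rw [AddCircle.coe_sub, hac]; abel
    rw [this]
    refine (QuotientAddGroup.norm_mk_le_norm).trans ?_
    rw [Real.norm_eq_abs, abs_le]
    constructor <;> linarith
  have hm := (MeasureTheory.measure_mono (μ := MeasureTheory.volume) cover).trans
    (MeasureTheory.measure_biUnion_finset_le P _)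
  rw [AddCircle.measure_univ] at hm
  have h2 : ∑ p ∈ P, MeasureTheory.volume
      (Metric.closedBall (((crGap P p / 2 : ℝ) : AddCircle (1 : ℝ)) + p) (crGap P p / 2))
      ≤ ∑ p ∈ P, ENNReal.ofReal (crGap P p) := by
    apply Finset.sum_le_sum
    intro p _
    rw [AddCircle.volume_closedBall]
    apply ENNReal.ofReal_le_ofReal
    refine (min_le_right _ _).trans (by linarith)
  have h3 := hm.trans h2
  rw [← ENNReal.ofReal_sum_of_nonneg (fun p _ => hg0 p)] at h3
  exact (ENNReal.ofReal_le_ofReal_iff (Finset.sum_nonneg fun p _ => hg0 p)).1 h3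

theorem cr_main (x : ℕ → AddCircle (1 : ℝ)) (n : ℕ) (hn : 1 ≤ n) :
    1 ≤ ∑ k ∈ Finset.range n, 2 * covRad x (n + k) := by
  classical
  set P : Finset (AddCircle (1 : ℝ)) := (Finset.Icc 1 n).image x with hPdef
  have hPn : P.Nonempty := ⟨x 1, Finset.mem_image_of_mem _ (by simp [hn])⟩
  refine (crGap_sum P hPn).trans ?_
  refine cr_abstract P n (Finset.card_image_le.trans (by simp))
    (fun k p => ∀ i ∈ Set.Icc 1 (n+k), ∀ r : ℝ, 0 < r → r < crGap P p →
      (r : AddCircle (1 : ℝ)) + p ≠ x i) (crGap P) (fun k => 2 * covRad x (n+k)) ?_ ?_ ?_ ?_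
  · intro k
    have := cr_le x (n+k) (by omega) 0 0 (fun i _ => dist_nonneg)
    simpa using this
  · intro p hp i hi r h0 h1 h
    apply crGap_notMem P p r h0 h1
    rw [h]
    exact Finset.mem_image_of_mem _ (by simpa using hi)
  · intro k p hp q hq hAp hAq hnp hnq
    have aux : ∀ p, (∀ i ∈ Set.Icc 1 (n+k), ∀ r : ℝ, 0 < r → r < crGap P p →
        (r : AddCircle (1 : ℝ)) + p ≠ x i) → (¬ ∀ i ∈ Set.Icc 1 (n+(k+1)), ∀ r : ℝ, 0 < r →
        r < crGap P p → (r : AddCircle (1 : ℝ)) + p ≠ x i) →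
        ∃ r : ℝ, 0 < r ∧ r < crGap P p ∧ (r : AddCircle (1 : ℝ)) + p = x (n+k+1) := by
      intro p hA hN
      push Not at hN
      obtain ⟨i, hi, r, h0, h1, h⟩ := hN
      have : i = n+k+1 := by
        by_contra hne
        exact hA i ⟨hi.1, by have := hi.2; omega⟩ r h0 h1 h
      subst this
      exact ⟨r, h0, h1, h⟩
    obtain ⟨a, ha0, ha1, ha⟩ := aux p hAp hnp
    obtain ⟨b, hb0, hb1, hb⟩ := aux q hAq hnq
    rcases le_total a b with hab | hab
    · exact crGap_disj P p q hp a b hb1 ha0 hab (ha.trans hb.symm)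
    · exact (crGap_disj P q p hq b a ha1 hb0 hab (hb.trans ha.symm)).symm
  · intro k p hp hA
    have := cr_le x (n+k) (by omega) (((crGap P p / 2 : ℝ) : AddCircle (1 : ℝ)) + p)
      (crGap P p / 2) ?_
    · linarith
    intro i hi
    by_contra hlt
    push Not at hlt
    rw [dist_comm, dist_eq_norm] at hlt
    obtain ⟨s0, hs0⟩ := QuotientAddGroup.mk_surjective
      (x i - (((crGap P p / 2 : ℝ) : AddCircle (1 : ℝ)) + p))
    have hs0' : (s0 : AddCircle (1:ℝ)) = x i - (((crGap P p / 2 : ℝ) : AddCircle (1 : ℝ)) + p) := hs0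
    rw [← hs0', AddCircle.norm_eq] at hlt
    set s : ℝ := s0 - round ((1:ℝ)⁻¹ * s0) * 1 with hs
    have hsc : (s : AddCircle (1:ℝ)) = (s0 : AddCircle (1:ℝ)) := by
      rw [hs, AddCircle.coe_sub, sub_eq_self, AddCircle.coe_eq_zero_iff]
      exact ⟨round ((1:ℝ)⁻¹ * s0), by simp⟩
    rw [abs_lt] at hlt
    refine hA i hi (crGap P p / 2 + s) (by linarith) (by linarith) ?_
    rw [AddCircle.coe_add, hsc, hs0']; abel

theorem cr_harm (n : ℕ) (hn : 1 ≤ n) (j : ℕ) :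
    ∑ k ∈ Finset.range j, 1 / ((n + k : ℕ) : ℝ) ≤
      1 / (n:ℝ) - 1 / ((n + j : ℕ) : ℝ) + (Real.log ((n + j : ℕ) : ℝ) - Real.log n) := by
  induction j with
  | zero => simp
  | succ j ih =>
    rw [Finset.sum_range_succ]
    have hm : (0:ℝ) < ((n + j : ℕ) : ℝ) := by exact_mod_cast (by omega : 0 < n + j)
    have e : ((n + (j + 1) : ℕ) : ℝ) = ((n + j : ℕ) : ℝ) + 1 := by push_cast; ring
    rw [e]
    generalize ((n + j : ℕ) : ℝ) = m at *
    have h := Real.one_sub_inv_le_log_of_pos (x := (m+1)/m) (by positivity)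
    rw [Real.log_div (by positivity) (by positivity)] at h
    have : 1 - ((m+1)/m)⁻¹ = 1/(m+1) := by field_simp; ring
    linarith

/-- For any sequence `x` in the unit circle, `limsup_{n→∞} n·D_n(x) ≥ 1/(2 ln 2)`
(stated in `EReal` so that the `limsup` is always meaningful). -/
theorem limsup_mul_covRad_ge (x : ℕ → AddCircle (1 : ℝ)) :
    ((1 / (2 * Real.log 2) : ℝ) : EReal) ≤
      Filter.limsup (fun n : ℕ => (((n : ℝ) * covRad x n : ℝ) : EReal)) Filter.atTop := by
  by_contra hcon
  push Not at hcon
  obtain ⟨c, hc1, hc2⟩ := EReal.lt_iff_exists_real_btwn.1 hcon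
  have hc2 : c < 1 / (2 * Real.log 2) := by exact_mod_cast hc2
  have hev := Filter.eventually_lt_of_limsup_lt hc1
  obtain ⟨N, hN⟩ := Filter.eventually_atTop.1 hev
  have hN' : ∀ n ≥ N, (n:ℝ) * covRad x n < c := fun n h => by exact_mod_cast hN n h
  have hl : 0 < Real.log 2 := Real.log_pos (by norm_num)
  have hc0 : 0 ≤ c := by
    have h1 := hN' (N+1) (by omega)
    have h2 := cr_le x (N+1) (by omega) 0 0 (fun i _ => dist_nonneg)
    have : 0 ≤ ((N+1:ℕ):ℝ) * covRad x (N+1) := by positivity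
    linarith
  have key : ∀ n ≥ N + 1, (1:ℝ) ≤ 2 * c * (1 / (n:ℝ) + Real.log 2) := by
    intro n hn
    have hn0 : (0:ℝ) < n := by exact_mod_cast (by omega : 0 < n)
    refine (cr_main x n (by omega)).trans ?_
    have h1 : ∑ k ∈ Finset.range n, 2 * covRad x (n + k) ≤
        2 * c * ∑ k ∈ Finset.range n, 1 / ((n + k : ℕ) : ℝ) := by
      rw [Finset.mul_sum]
      apply Finset.sum_le_sum
      intro k _
      have hm : (0:ℝ) < ((n + k : ℕ) : ℝ) := by exact_mod_cast (by omega : 0 < n + k)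
      have := hN' (n+k) (by omega)
      rw [mul_one_div, le_div_iff₀ hm]
      linarith
    refine h1.trans (mul_le_mul_of_nonneg_left ?_ (by linarith))
    refine (cr_harm n (by omega) n).trans ?_
    have e : ((n + n : ℕ) : ℝ) = 2 * n := by push_cast; ring
    rw [e, Real.log_mul (by norm_num) hn0.ne']
    have : 0 ≤ 1 / (2 * (n:ℝ)) := by positivity
    linarith
  have hlim : Filter.Tendsto (fun n : ℕ => 2 * c * (1 / (n:ℝ) + Real.log 2)) Filter.atTop
      (nhds (2 * c * (0 + Real.log 2))) :=
    (tendsto_one_div_atTop_nhds_zero_nat.add_const _).const_mul _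
  have := ge_of_tendsto hlim (Filter.eventually_atTop.2 ⟨N+1, key⟩)
  rw [lt_div_iff₀ (by positivity)] at hc2
  linarith
end

section
/- For every sequence x = (x_k)_{k≥1} of points of the unit circle 𝕋 = ℝ/ℤ, one has liminf_{n→∞} n · d_n(x) ≤ 1/(2 ln 2). -/
/-- The minimal pairwise distance `d_n(x)` among the first `n` terms of a
sequence `x` in the unit circle `𝕋 = ℝ/ℤ`. -/
noncomputable def minSep (x : ℕ → AddCircle (1 : ℝ)) (n : ℕ) : ℝ :=
  sInf {d : ℝ | ∃ r s : ℕ, 1 ≤ r ∧ r < s ∧ s ≤ n ∧ d = dist (x r) (x s)}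

lemma minSep_le_dist (x : ℕ → AddCircle (1 : ℝ)) (k i j : ℕ) (hi : 1 ≤ i) (hj : 1 ≤ j)
    (hik : i ≤ k) (hjk : j ≤ k) (hij : i ≠ j) : minSep x k ≤ dist (x i) (x j) := by
  have hb : BddBelow {d : ℝ | ∃ r s : ℕ, 1 ≤ r ∧ r < s ∧ s ≤ k ∧ d = dist (x r) (x s)} := by
    refine ⟨0, ?_⟩
    rintro d ⟨r, s, -, -, -, rfl⟩
    exact dist_nonneg
  rcases lt_or_gt_of_ne hij with h | h
  · exact csInf_le hb ⟨i, j, hi, h, hjk, rfl⟩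
  · exact csInf_le hb ⟨j, i, hj, h, hik, dist_comm _ _⟩

lemma dist_coe_le (a b : ℝ) : dist (a : AddCircle (1 : ℝ)) (b : AddCircle (1 : ℝ)) ≤ |a - b| := by
  rw [dist_eq_norm, ← AddCircle.coe_sub, ← Real.norm_eq_abs]
  exact QuotientAddGroup.norm_mk_le_norm

/-- Points on the circle can be cyclically ordered with total consecutive distance at most 1. -/
lemma exists_perm (p : ℕ) (z : Fin (p + 1) → AddCircle (1 : ℝ)) :
    ∃ σ : Equiv.Perm (Fin (p + 1)), ∑ j, dist (z (σ j)) (z (σ (j + 1))) ≤ 1 := by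
  have hz : ∀ i, ∃ y : ℝ, 0 ≤ y ∧ y < 1 ∧ (y : AddCircle (1 : ℝ)) = z i := by
    intro i
    have : Fact ((0 : ℝ) < 1) := ⟨one_pos⟩
    obtain ⟨y, hy, h⟩ := (AddCircle.coe_image_Ico_eq (1 : ℝ) 0).symm ▸ Set.mem_univ (z i)
    exact ⟨y, hy.1, by simpa using hy.2, h⟩
  choose y h0 h1 hy using hz
  refine ⟨Tuple.sort y, ?_⟩
  set σ := Tuple.sort y with hσ
  have hm : Monotone (y ∘ σ) := Tuple.monotone_sort y
  have key : ∀ j : Fin (p + 1), dist (z (σ j)) (z (σ (j + 1))) ≤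
      y (σ (j + 1)) - y (σ j) + (if j = Fin.last p then 1 else 0) := by
    intro j
    by_cases hj : j = Fin.last p
    · subst hj
      rw [if_pos rfl, ← hy, ← hy]
      have e : ((y (σ (Fin.last p + 1)) : ℝ) : AddCircle (1 : ℝ)) =
          ((y (σ (Fin.last p + 1)) + 1 : ℝ) : AddCircle (1 : ℝ)) := by
        rw [AddCircle.coe_add, AddCircle.coe_period, add_zero]
      rw [e]
      refine (dist_coe_le _ _).trans ?_
      rw [abs_sub_comm, abs_of_nonneg]
      · linarith
      · linarith [h0 (σ (Fin.last p + 1)), h1 (σ (Fin.last p))]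
    · rw [if_neg hj, ← hy, ← hy]
      refine (dist_coe_le _ _).trans ?_
      have hle : j ≤ j + 1 := by
        rw [Fin.le_def, Fin.val_add_one, if_neg hj]; omega
      have := hm hle
      simp only [Function.comp] at this
      rw [abs_sub_comm, abs_of_nonneg] <;> linarith
  refine (Finset.sum_le_sum fun j _ => key j).trans ?_
  rw [Finset.sum_add_distrib, Finset.sum_sub_distrib]
  have := Equiv.sum_comp (Equiv.addRight (1 : Fin (p + 1))) (fun j => y (σ j))
  simp only [Equiv.coe_addRight] at this
  rw [this]
  simp

lemma key_bound (x : ℕ → AddCircle (1 : ℝ)) (c : ℝ) (hc : 0 < c) (n : ℕ) (hn : 1 ≤ n)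
    (h : ∀ k, n ≤ k → c < k * minSep x k) :
    2 * c * ∑ i ∈ Finset.range n, 1 / ((n : ℝ) + i + 1) ≤ 1 := by
  obtain ⟨p, hp⟩ : ∃ p, n + n = p + 1 := ⟨n + n - 1, by omega⟩
  obtain ⟨σ, hs⟩ := exists_perm p (fun i => x (i + 1))
  have hn0 : (0 : ℝ) < n := by exact_mod_cast hn
  let f : ℕ → ℝ := fun k => c / (max (k + 1) n : ℕ)
  have hfM : ∀ k, f k ≤ c / n := by
    intro k
    apply div_le_div_of_nonneg_left hc.le hn0
    exact_mod_cast le_max_right _ _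
  have hd : ∀ j : Fin (p + 1), f (σ j) + f (σ (j + 1)) - c / n ≤
      dist (x (σ j + 1)) (x (σ (j + 1) + 1)) := by
    intro j
    have hne : (σ j : ℕ) ≠ (σ (j + 1) : ℕ) := by
      intro e
      have e' := σ.injective (Fin.ext e)
      have e2 := congrArg Fin.val e'
      rw [Fin.val_add_one] at e2
      split_ifs at e2 with hl
      · rw [hl] at e2; simp at e2; omega
      · omega
    generalize (σ j : ℕ) = a at *
    generalize (σ (j + 1) : ℕ) = b at *
    have aux : ∀ k, n ≤ k → a + 1 ≤ k → b + 1 ≤ k →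
        c / k ≤ dist (x (a + 1)) (x (b + 1)) := by
      intro k h1 h2 h3
      have hk : (0 : ℝ) < k := by exact_mod_cast (by omega : 0 < k)
      refine le_trans ?_ (minSep_le_dist x k (a + 1) (b + 1) (by omega) (by omega) h2 h3 (by omega))
      rw [div_le_iff₀ hk]
      linarith [h k h1]
    rcases le_total a b with hab | hab
    · have h1 := aux (max (b + 1) n) (by omega) (by omega) (by omega)
      have h2 := hfM a
      change c / _ ≤ _ at h1
      change f a + c / ((max (b + 1) n : ℕ) : ℝ) - c / n ≤ _
      linarith
    · have h1 := aux (max (a + 1) n) (by omega) (by omega) (by omega)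
      have h2 := hfM b
      change c / ((max (a + 1) n : ℕ) : ℝ) + f b - c / n ≤ _
      linarith
  have hsum := (Finset.sum_le_sum fun j (_ : j ∈ Finset.univ) => hd j).trans hs
  rw [Finset.sum_sub_distrib, Finset.sum_add_distrib] at hsum
  have e1 : ∑ j, f (σ j) = ∑ j : Fin (p + 1), f j :=
    Equiv.sum_comp σ (fun j : Fin (p + 1) => f j)
  have e2 : ∑ j, f (σ (j + 1)) = ∑ j : Fin (p + 1), f j := by
    rw [← e1]
    exact Equiv.sum_comp (Equiv.addRight (1 : Fin (p + 1))) (fun j => f (σ j))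
  have e3 : ∑ j : Fin (p + 1), f j = c + c * ∑ i ∈ Finset.range n, 1 / ((n : ℝ) + i + 1) := by
    rw [Fin.sum_univ_eq_sum_range (fun j => f j), ← hp, Finset.sum_range_add]
    congr 1
    · rw [Finset.sum_congr rfl (g := fun _ => c / (n : ℝ))]
      · simp; field_simp
      · intro k hk
        have := Finset.mem_range.1 hk
        simp only [f]
        rw [max_eq_right (by omega)]
    · rw [Finset.mul_sum]
      refine Finset.sum_congr rfl fun k hk => ?_
      simp only [f]
      rw [max_eq_left (by omega)]
      push_cast
      ring
  rw [e1, e2, e3] at hsum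
  have e4 : ∑ j : Fin (p + 1), c / (n : ℝ) = 2 * c := by
    have : ((p + 1 : ℕ) : ℝ) = n + n := by rw [← hp]; push_cast; ring
    rw [Finset.sum_const, Finset.card_univ, Fintype.card_fin, nsmul_eq_mul, this]
    field_simp; ring
  rw [e4] at hsum
  linarith

lemma log_le_sum (n m : ℕ) : Real.log ((n + m + 1 : ℝ) / (n + 1)) ≤
    ∑ i ∈ Finset.range m, 1 / ((n : ℝ) + i + 1) := by
  induction m with
  | zero =>
    have : (n : ℝ) + 1 ≠ 0 := by positivity
    simp [this]
  | succ m ih =>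
    rw [Finset.sum_range_succ]
    have hpos : (0 : ℝ) < n + m + 1 := by positivity
    have h2 := Real.log_le_sub_one_of_pos (x := ((n : ℝ) + (m + 1) + 1) / (n + m + 1))
      (by positivity)
    have e : ((n : ℝ) + (m + 1) + 1) / (n + m + 1) - 1 = 1 / (n + m + 1) := by
      field_simp; ring
    have e3 : ((n : ℝ) + (m + 1) + 1) / (n + 1) =
        ((n + m + 1 : ℝ) / (n + 1)) * (((n : ℝ) + (m + 1) + 1) / (n + m + 1)) := by
      field_simp
    push_cast
    rw [e3, Real.log_mul (by positivity) (by positivity)]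
    linarith

/-- For any sequence `x` in the unit circle, `liminf_{n→∞} n·d_n(x) ≤ 1/(2 ln 2)`
(stated in `EReal` so that the `liminf` is always meaningful). -/
theorem liminf_mul_minSep_le (x : ℕ → AddCircle (1 : ℝ)) :
    Filter.liminf (fun n : ℕ => (((n : ℝ) * minSep x n : ℝ) : EReal)) Filter.atTop ≤
      ((1 / (2 * Real.log 2) : ℝ) : EReal) := by
  by_contra! hlt
  obtain ⟨c, hc1, hc2⟩ := EReal.lt_iff_exists_real_btwn.1 hlt
  have hev := Filter.eventually_lt_of_lt_liminf hc2
  obtain ⟨N, hN⟩ := Filter.eventually_atTop.1 hev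
  have hl : 0 < Real.log 2 := Real.log_pos (by norm_num)
  have hc1' : 1 / (2 * Real.log 2) < c := by exact_mod_cast hc1
  have hc : 0 < c := lt_trans (by positivity) hc1'
  have hb : ∀ n : ℕ, max N 1 ≤ n → 2 * c * Real.log ((n + n + 1 : ℝ) / (n + 1)) ≤ 1 := by
    intro n hn
    refine le_trans ?_ (key_bound x c hc n (by omega) fun k hk => ?_)
    · exact mul_le_mul_of_nonneg_left (log_le_sum n n) (by positivity)
    · exact_mod_cast hN k (by omega)
  have ht : Filter.Tendsto (fun n : ℕ => 2 * c * Real.log ((n + n + 1 : ℝ) / (n + 1)))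
      Filter.atTop (nhds (2 * c * Real.log 2)) := by
    refine Filter.Tendsto.const_mul _ (Filter.Tendsto.log ?_ (by norm_num))
    have h1 : Filter.Tendsto (fun n : ℕ => (2 : ℝ) - 1 / ((n : ℝ) + 1)) Filter.atTop
        (nhds (2 - 0)) := tendsto_const_nhds.sub tendsto_one_div_add_atTop_nhds_zero_nat
    rw [sub_zero] at h1
    refine h1.congr fun n => ?_
    have : (n : ℝ) + 1 ≠ 0 := by positivity
    field_simp; ring
  have hle := le_of_tendsto ht (Filter.eventually_atTop.2 ⟨max N 1, hb⟩)
  rw [div_lt_iff₀ (by positivity)] at hc1'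
  linarith
end

section
/- For the sequence y = (y_k)_{k≥1} in the unit circle 𝕋 = ℝ/ℤ given by y_k = log₂(2k − 1) (mod 1), one has D_n(y) = φ_n for every n ≥ 1. -/
/-- The sequence `y_k = log₂(2k − 1) (mod 1)` in the unit circle. -/
noncomputable def ySeq (k : ℕ) : AddCircle (1 : ℝ) :=
  ((Real.logb 2 (2 * (k : ℝ) - 1) : ℝ) : AddCircle (1 : ℝ))

lemma ySeq_hit (n m : ℕ) (h1 : 1 ≤ m) (h2 : m ≤ 2 * n) :
    ∃ k ∈ Set.Icc 1 n, ySeq k = ((Real.logb 2 (m : ℝ) : ℝ) : AddCircle (1 : ℝ)) := by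
  obtain ⟨j, q, ⟨r, hr⟩, hm⟩ := Nat.exists_eq_two_pow_mul_odd (n := m) (by omega)
  have hq : q ≤ m := by
    rw [hm]; exact Nat.le_mul_of_pos_left _ (by positivity)
  refine ⟨r + 1, ⟨by omega, by omega⟩, ?_⟩
  unfold ySeq
  have e1 : (2 * ((r + 1 : ℕ) : ℝ) - 1) = (q : ℝ) := by
    rw [hr]; push_cast; ring
  have hq0 : (q : ℝ) ≠ 0 := by
    have : q ≠ 0 := by omega
    exact_mod_cast this
  have e2 : Real.logb 2 (m : ℝ) = Real.logb 2 (q : ℝ) + (j : ℝ) := by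
    rw [hm]; push_cast
    rw [Real.logb_mul (by positivity) hq0, Real.logb_pow, Real.logb_self_eq_one (by norm_num)]
    ring
  rw [e1, e2, AddCircle.coe_add]
  have : ((j : ℝ) : AddCircle (1 : ℝ)) = 0 := by
    rw [AddCircle.coe_eq_zero_iff]
    exact ⟨j, by simp⟩
  rw [this, add_zero]

lemma phi_eq (n : ℕ) : phi n = (Real.logb 2 (n + 1) - Real.logb 2 n) / 2 := by
  unfold phi Real.logb
  have : Real.log 2 ≠ 0 := (Real.log_pos (by norm_num)).ne'
  field_simp

lemma gap_le (n m : ℕ) (hn : 1 ≤ n) (h : n ≤ m) :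
    Real.logb 2 ((m : ℝ) + 1) - Real.logb 2 m ≤ Real.logb 2 ((n : ℝ) + 1) - Real.logb 2 n := by
  have hn' : (1 : ℝ) ≤ n := by exact_mod_cast hn
  have hm' : (n : ℝ) ≤ m := by exact_mod_cast h
  rw [← Real.logb_div (by positivity) (by linarith), ← Real.logb_div (by positivity) (by linarith)]
  apply Real.logb_le_logb_of_le (by norm_num)
  · have : (0 : ℝ) < m := by linarith
    positivity
  · rw [div_le_div_iff₀ (by linarith) (by linarith)]
    nlinarith

lemma upper (n : ℕ) (hn : 1 ≤ n) (t : AddCircle (1 : ℝ)) :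
    sInf ((fun k => dist t (ySeq k)) '' Set.Icc 1 n) ≤ phi n := by
  have hn' : (1 : ℝ) ≤ n := by exact_mod_cast hn
  have key : ∀ m : ℕ, 1 ≤ m → m ≤ 2 * n → ∀ s : ℝ, (s : AddCircle (1 : ℝ)) = t →
      sInf ((fun k => dist t (ySeq k)) '' Set.Icc 1 n) ≤ |s - Real.logb 2 m| := by
    intro m h1 h2 s hs
    obtain ⟨k, hk, e⟩ := ySeq_hit n m h1 h2
    refine (csInf_le (a := dist t (ySeq k)) (s := (fun k => dist t (ySeq k)) '' Set.Icc 1 n)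
      ⟨0, ?_⟩ ⟨k, hk, rfl⟩).trans ?_
    · rintro _ ⟨k, _, rfl⟩; exact dist_nonneg
    · show dist t (ySeq k) ≤ _
      rw [e, ← hs]; exact dist_coe_le _ _
  obtain ⟨s, ⟨hs1, hs2⟩, hs⟩ : ∃ s ∈ Set.Ico (Real.logb 2 n) (Real.logb 2 n + 1),
      (s : AddCircle (1 : ℝ)) = t := by
    have := AddCircle.coe_image_Ico_eq (1 : ℝ) (Real.logb 2 n)
    have h : t ∈ (Set.univ : Set (AddCircle (1 : ℝ))) := trivial
    rw [← this] at h
    exact h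
  have hu1 : (n : ℝ) ≤ (2 : ℝ) ^ s :=
    (Real.logb_le_iff_le_rpow (by norm_num) (by linarith)).1 hs1
  have hu2 : (2 : ℝ) ^ s < 2 * n := by
    have h := Real.rpow_lt_rpow_of_exponent_lt (x := 2) (by norm_num) hs2
    rw [Real.rpow_add (by norm_num), Real.rpow_logb (by norm_num) (by norm_num) (by linarith),
      Real.rpow_one] at h
    linarith
  set m := ⌊(2 : ℝ) ^ s⌋₊ with hm
  have hnm : n ≤ m := Nat.le_floor hu1
  have hmu : (m : ℝ) ≤ (2 : ℝ) ^ s := Nat.floor_le (by positivity)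
  have hmu2 : (2 : ℝ) ^ s < (m : ℝ) + 1 := Nat.lt_floor_add_one _
  have hm2 : m < 2 * n := by
    have : (m : ℝ) < 2 * n := by linarith
    exact_mod_cast this
  have hm0 : (0 : ℝ) < m := by
    have : 0 < m := by omega
    exact_mod_cast this
  have a1 : Real.logb 2 m ≤ s := (Real.logb_le_iff_le_rpow (by norm_num) hm0).2 hmu
  have a2 : s ≤ Real.logb 2 ((m : ℝ) + 1) :=
    (Real.le_logb_iff_rpow_le (by norm_num) (by linarith)).2 hmu2.le
  have k1 := key m (by omega) (by omega) s hs
  have k2 := key (m + 1) (by omega) (by omega) s hs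
  push_cast at k2
  rw [abs_of_nonneg (by linarith)] at k1
  rw [abs_of_nonpos (by linarith)] at k2
  have g := gap_le n m hn hnm
  rw [phi_eq]
  linarith

lemma sep (n k : ℕ) (hn : 1 ≤ n) (hk : k ∈ Set.Icc 1 n) (j : ℤ) :
    Real.logb 2 (2 * (k : ℝ) - 1) + j ≤ Real.logb 2 n ∨
      Real.logb 2 ((n : ℝ) + 1) ≤ Real.logb 2 (2 * (k : ℝ) - 1) + j := by
  obtain ⟨h1, h2⟩ := hk
  have hn' : (1 : ℝ) ≤ n := by exact_mod_cast hn
  have h1' : (1 : ℝ) ≤ k := by exact_mod_cast h1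
  have h2' : (k : ℝ) ≤ n := by exact_mod_cast h2
  rcases le_or_gt 0 j with hj | hj
  · obtain ⟨i, rfl⟩ := Int.eq_ofNat_of_zero_le hj
    have e : Real.logb 2 (2 * (k : ℝ) - 1) + ((i : ℤ) : ℝ) =
        Real.logb 2 (((2 * k - 1) * 2 ^ i : ℕ) : ℝ) := by
      have : ((2 * k - 1 : ℕ) : ℝ) = 2 * (k : ℝ) - 1 := by
        rw [Nat.cast_sub (by omega)]; push_cast; ring
      rw [Nat.cast_mul, this, Nat.cast_pow,
        Real.logb_mul (by linarith) (by positivity), Nat.cast_ofNat, Real.logb_pow,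
        Real.logb_self_eq_one (by norm_num)]
      simp
    rw [e]
    have hpos : 0 < (2 * k - 1) * 2 ^ i := by
      have : 0 < 2 * k - 1 := by omega
      positivity
    rcases Nat.lt_or_ge n ((2 * k - 1) * 2 ^ i) with h | h
    · right
      apply Real.logb_le_logb_of_le (by norm_num) (by linarith)
      exact_mod_cast h
    · left
      apply Real.logb_le_logb_of_le (by norm_num) (by exact_mod_cast hpos)
      exact_mod_cast h
  · left
    have hj' : (j : ℝ) ≤ -1 := by exact_mod_cast (by omega : j ≤ -1)
    have : Real.logb 2 (2 * (k : ℝ) - 1) ≤ Real.logb 2 (2 * n) :=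
      Real.logb_le_logb_of_le (by norm_num) (by linarith) (by linarith)
    rw [Real.logb_mul (by norm_num) (by linarith), Real.logb_self_eq_one (by norm_num)] at this
    linarith

lemma lower (n : ℕ) (hn : 1 ≤ n) :
    phi n ≤ sInf ((fun k => dist
      (((Real.logb 2 n + Real.logb 2 ((n : ℝ) + 1)) / 2 : ℝ) : AddCircle (1 : ℝ)) (ySeq k))
        '' Set.Icc 1 n) := by
  apply le_csInf
  · exact ⟨_, 1, ⟨le_rfl, hn⟩, rfl⟩
  · rintro _ ⟨k, hk, rfl⟩
    show phi n ≤ dist _ (ySeq k)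
    unfold ySeq
    rw [dist_eq_norm, ← AddCircle.coe_sub, AddCircle.norm_eq, phi_eq]
    set j := round ((1 : ℝ)⁻¹ * ((Real.logb 2 n + Real.logb 2 ((n : ℝ) + 1)) / 2 -
      Real.logb 2 (2 * (k : ℝ) - 1)))
    rcases sep n k hn hk j with h | h
    · refine le_trans ?_ (le_abs_self _)
      linarith
    · refine le_trans ?_ (neg_le_abs _)
      linarith

/-- For the sequence `y_k = log₂(2k − 1) (mod 1)` one has `D_n(y) = φ_n` for all `n ≥ 1`. -/
theorem covRad_ySeq (n : ℕ) (hn : 1 ≤ n) : covRad ySeq n = phi n := by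
  unfold covRad
  apply le_antisymm
  · exact ciSup_le (upper n hn)
  · refine (lower n hn).trans (le_ciSup (f := fun t : AddCircle (1 : ℝ) =>
      sInf ((fun k => dist t (ySeq k)) '' Set.Icc 1 n)) ⟨phi n, ?_⟩ _)
    rintro _ ⟨t, rfl⟩
    exact upper n hn t
end

section
/- For the sequence y = (y_k)_{k≥1} in the unit circle 𝕋 = ℝ/ℤ given by y_k = log₂(2k − 1) (mod 1), one has d_n(y) = 2φ_{2n−1} = (ln(2n) − ln(2n−1))/ln 2 for every n ≥ 2. -/
theorem core_aux (N A B : ℕ) (hA : 1 ≤ A) (hAB : A < B) (hN : A ≤ N) :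
    Real.log ((N : ℝ) + 1) - Real.log N ≤ Real.log B - Real.log A := by
  have hA' : (1 : ℝ) ≤ A := by exact_mod_cast hA
  have hN' : (A : ℝ) ≤ N := by exact_mod_cast hN
  have hB' : (A : ℝ) + 1 ≤ B := by exact_mod_cast hAB
  have h : Real.log (((N : ℝ) + 1) * A) ≤ Real.log (B * N) := by
    apply Real.log_le_log
    · positivity
    · nlinarith
  rw [Real.log_mul (by positivity) (by positivity),
    Real.log_mul (by linarith) (by linarith)] at h
  linarith

theorem core_abs (N A B : ℕ) (hA : 1 ≤ A) (hB : 1 ≤ B) (hAB : A ≠ B) (hN : A ≤ N ∨ B ≤ N) :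
    Real.log ((N : ℝ) + 1) - Real.log N ≤ |Real.log A - Real.log B| := by
  rcases lt_or_gt_of_ne hAB with h | h
  · rw [abs_sub_comm]
    exact (core_aux N A B hA h (by omega)).trans (le_abs_self _)
  · exact (core_aux N B A hB h (by omega)).trans (le_abs_self _)

theorem core_nat (N a b k : ℕ) (ha : Odd a) (hb : Odd b) (hab : a ≠ b) (hN : b ≤ N) :
    Real.log ((N : ℝ) + 1) - Real.log N ≤ |Real.log a + k * Real.log 2 - Real.log b| := by
  have hne : a * 2 ^ k ≠ b := by
    rintro rfl
    rcases Nat.eq_zero_or_pos k with rfl | hk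
    · simp at hab
    · rw [Nat.odd_mul, Nat.odd_pow_iff hk.ne'] at hb
      exact absurd hb.2 (by decide)
  have ha0 := ha.pos
  have h := core_abs N (a * 2 ^ k) b (Nat.mul_pos ha0 (by positivity)) hb.pos hne (Or.inr hN)
  have ha1 : (a : ℝ) ≠ 0 := by exact_mod_cast ha0.ne'
  push_cast at h
  rwa [Real.log_mul ha1 (by positivity), Real.log_pow] at h

theorem core_int (N a b : ℕ) (m : ℤ) (ha : Odd a) (hb : Odd b) (hab : a ≠ b) (hN : b ≤ N)
    (hM : a ≤ N) :
    (Real.log ((N : ℝ) + 1) - Real.log N) / Real.log 2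
      ≤ |Real.logb 2 a - Real.logb 2 b - m| := by
  have h2 : 0 < Real.log 2 := Real.log_pos (by norm_num)
  have e : Real.logb 2 a - Real.logb 2 b - m
      = (Real.log a - Real.log b - m * Real.log 2) / Real.log 2 := by
    simp only [Real.logb]; field_simp
  rw [e, abs_div, abs_of_pos h2]
  apply div_le_div_of_nonneg_right _ h2.le
  obtain ⟨k, rfl | rfl⟩ := m.eq_nat_or_neg
  · have := core_nat N b a k hb ha hab.symm hM
    rw [abs_sub_comm] at this
    refine this.trans (le_of_eq (congrArg abs ?_))
    push_cast; ring
  · have := core_nat N a b k ha hb hab hN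
    refine this.trans (le_of_eq (congrArg abs ?_))
    push_cast; ring

theorem ySeq_dist (r s : ℕ) (hr : 1 ≤ r) (hs : 1 ≤ s) : dist (ySeq r) (ySeq s) =
    |Real.logb 2 ((2 * r - 1 : ℕ) : ℝ) - Real.logb 2 ((2 * s - 1 : ℕ) : ℝ) -
      round (Real.logb 2 ((2 * r - 1 : ℕ) : ℝ) - Real.logb 2 ((2 * s - 1 : ℕ) : ℝ))| := by
  rw [Nat.cast_sub (by omega), Nat.cast_sub (by omega), dist_eq_norm, ySeq, ySeq,
    ← AddCircle.coe_sub, AddCircle.norm_eq]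
  simp

theorem minSep_aux (n : ℕ) (hn : 2 ≤ n) :
    minSep ySeq n = (Real.log (((2 * n - 1 : ℕ) : ℝ) + 1) - Real.log ((2 * n - 1 : ℕ) : ℝ))
      / Real.log 2 := by
  have h2 : 0 < Real.log 2 := Real.log_pos (by norm_num)
  have lower : ∀ r s : ℕ, 1 ≤ r → r < s → s ≤ n →
      (Real.log (((2 * n - 1 : ℕ) : ℝ) + 1) - Real.log ((2 * n - 1 : ℕ) : ℝ))
      / Real.log 2 ≤ dist (ySeq r) (ySeq s) := by
    intro r s hr hrs hs
    rw [ySeq_dist r s hr (by omega)]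
    exact core_int _ _ _ _ ⟨r - 1, by omega⟩ ⟨s - 1, by omega⟩ (by omega) (by omega) (by omega)
  apply IsLeast.csInf_eq
  refine ⟨?_, ?_⟩
  · obtain ⟨k, q, hq, hk⟩ := Nat.exists_eq_two_pow_mul_odd (n := n) (by omega)
    obtain ⟨t, rfl⟩ := hq
    have hle : 2 * t + 1 ≤ n := by
      rw [hk]; exact Nat.le_mul_of_pos_left _ (by positivity)
    refine ⟨t + 1, n, by omega, by omega, le_rfl, le_antisymm
      (lower _ _ (by omega) (by omega) le_rfl) ?_⟩
    rw [ySeq_dist _ _ (by omega) (by omega)]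
    refine (round_le _ (-((k : ℤ) + 1))).trans ?_
    have e1 : 2 * (t + 1) - 1 = 2 * t + 1 := by omega
    have e2 : ((2 * n - 1 : ℕ) : ℝ) + 1 = 2 ^ (k + 1) * ((2 * t + 1 : ℕ) : ℝ) := by
      have : 2 * n - 1 + 1 = 2 ^ (k + 1) * (2 * t + 1) := by
        rw [pow_succ, mul_comm (2 ^ k) 2, mul_assoc, ← hk]; omega
      exact_mod_cast this
    have e3 : Real.log (((2 * n - 1 : ℕ) : ℝ) + 1)
        = (k + 1) * Real.log 2 + Real.log ((2 * t + 1 : ℕ) : ℝ) := by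
      rw [e2, Real.log_mul (by positivity) (by positivity), Real.log_pow]
      push_cast; ring
    have hp : (0 : ℝ) < ((2 * n - 1 : ℕ) : ℝ) := by
      exact_mod_cast (by omega : 0 < 2 * n - 1)
    have h0 : 0 ≤ (Real.log (((2 * n - 1 : ℕ) : ℝ) + 1) - Real.log ((2 * n - 1 : ℕ) : ℝ))
      / Real.log 2 :=
      div_nonneg (sub_nonneg.2 (Real.log_le_log hp (by linarith))) h2.le
    rw [e1]
    refine le_of_eq ?_
    rw [← abs_of_nonneg h0, e3]
    congr 1
    simp only [Real.logb]
    push_cast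
    field_simp
    ring
  · rintro d ⟨r, s, hr, hrs, hs, rfl⟩
    exact lower r s hr hrs hs

/-- For the sequence `y_k = log₂(2k − 1) (mod 1)` one has
`d_n(y) = 2 φ_{2n−1} = (ln(2n) − ln(2n−1))/ln 2` for all `n ≥ 2`. -/
theorem minSep_ySeq (n : ℕ) (hn : 2 ≤ n) :
    minSep ySeq n = 2 * phi (2 * n - 1) ∧
      2 * phi (2 * n - 1) = (Real.log (2 * (n : ℝ)) - Real.log (2 * (n : ℝ) - 1)) / Real.log 2 := by
  have h2 : 0 < Real.log 2 := Real.log_pos (by norm_num)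
  refine ⟨?_, ?_⟩
  · rw [minSep_aux n hn, phi]
    field_simp
  · rw [phi, Nat.cast_sub (by omega)]
    push_cast
    rw [sub_add_cancel]
    field_simp
end

section
/- For the sequence y = (y_k)_{k≥1} in the unit circle 𝕋 = ℝ/ℤ given by y_k = log₂(2k − 1) (mod 1), the limit lim_{n→∞} n · D_n(y) exists and equals 1/(2 ln 2). -/
theorem aux_norm_le (x : ℝ) (z : ℤ) : ‖(x : AddCircle (1:ℝ))‖ ≤ |x - z| := by
  have h := AddCircle.norm_eq (p := 1) (x := x)
  rw [h]
  simpa using round_le x z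

theorem aux_norm_ge (x h : ℝ) (H : ∀ z : ℤ, h ≤ |x - z|) : h ≤ ‖(x : AddCircle (1:ℝ))‖ := by
  have h := AddCircle.norm_eq (p := 1) (x := x)
  rw [h]
  simpa using H (round x)

theorem aux_exists (n j : ℕ) (hj : 1 ≤ j) (hj2 : j ≤ 2 * n) :
    ∃ k ∈ Set.Icc 1 n, ∃ a : ℤ, Real.logb 2 (2 * (k : ℝ) - 1) = Real.logb 2 j - a := by
  obtain ⟨a, m, ⟨r, hr⟩, hm⟩ := Nat.exists_eq_two_pow_mul_odd (n := j) (by omega)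
  have hle : m ≤ j := by
    rw [hm]; exact Nat.le_mul_of_pos_left _ (by positivity)
  refine ⟨r + 1, ⟨by omega, by omega⟩, a, ?_⟩
  have hmpos : (m : ℝ) ≠ 0 := by
    have : m ≠ 0 := by omega
    exact_mod_cast this
  have e : (2 * ((r + 1 : ℕ) : ℝ) - 1) = m := by
    rw [hr]; push_cast; ring
  rw [e, hm]
  push_cast
  rw [Real.logb_mul (by positivity) hmpos, Real.logb_pow, Real.logb_self_eq_one (by norm_num)]
  ring

theorem aux_gap (n j : ℕ) (hn : 1 ≤ n) (hj : n ≤ j) :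
    Real.logb 2 ((j : ℝ) + 1) - Real.logb 2 j ≤ Real.logb 2 ((n : ℝ) + 1) - Real.logb 2 n := by
  have hn' : (1 : ℝ) ≤ n := by exact_mod_cast hn
  have hj' : (n : ℝ) ≤ j := by exact_mod_cast hj
  rw [← Real.logb_div (by linarith) (by linarith), ← Real.logb_div (by linarith) (by linarith)]
  apply Real.logb_le_logb_of_le (by norm_num) (div_pos (by linarith) (by linarith))
  rw [div_le_div_iff₀ (by linarith) (by linarith)]
  nlinarith

theorem aux_upper (n : ℕ) (hn : 1 ≤ n) (t : AddCircle (1 : ℝ)) :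
    sInf ((fun k => dist t (ySeq k)) '' Set.Icc 1 n) ≤
      (Real.logb 2 ((n : ℝ) + 1) - Real.logb 2 n) / 2 := by
  have hn' : (1 : ℝ) ≤ n := by exact_mod_cast hn
  obtain ⟨s, rfl⟩ := QuotientAddGroup.mk_surjective t
  have key : ∀ j : ℕ, 1 ≤ j → j ≤ 2 * n → ∀ z : ℤ,
      sInf ((fun k => dist ((s : ℝ) : AddCircle (1 : ℝ)) (ySeq k)) '' Set.Icc 1 n) ≤
        |s - z - Real.logb 2 j| := by
    intro j h1 h2 z
    obtain ⟨k, hk, a, ha⟩ := aux_exists n j h1 h2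
    refine (csInf_le ⟨0, ?_⟩ (Set.mem_image_of_mem _ hk)).trans ?_
    · rintro _ ⟨k, -, rfl⟩
      exact dist_nonneg
    · simp only [ySeq]
      rw [dist_eq_norm, ← AddCircle.coe_sub, ha]
      refine (aux_norm_le _ (z + a)).trans (le_of_eq ?_)
      congr 1
      push_cast
      ring
  set z := ⌊s - Real.logb 2 n⌋ with hz
  have hz1 := Int.floor_le (s - Real.logb 2 n)
  have hz2 := Int.lt_floor_add_one (s - Real.logb 2 n)
  rw [← hz] at hz1 hz2
  set u := s - z with hu
  set x := (2 : ℝ) ^ u with hx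
  have hux : u = Real.logb 2 x := by
    rw [hx, Real.logb_rpow (by norm_num) (by norm_num)]
  have hxpos : 0 < x := by positivity
  have hx1 : (n : ℝ) ≤ x := by
    rw [← Real.logb_le_logb (b := 2) (by norm_num) (by linarith) hxpos, ← hux]
    linarith
  have hx2 : x < 2 * n := by
    rw [← Real.logb_lt_logb_iff (b := 2) (by norm_num) hxpos (by linarith), ← hux,
      Real.logb_mul (by norm_num) (by linarith), Real.logb_self_eq_one (by norm_num)]
    linarith
  set j := ⌊x⌋₊ with hj
  have hj1 : (j : ℝ) ≤ x := Nat.floor_le hxpos.le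
  have hj2 : x < j + 1 := Nat.lt_floor_add_one x
  have hnj : n ≤ j := Nat.le_floor hx1
  have hj2n : j < 2 * n := by
    have : (j : ℝ) < 2 * n := lt_of_le_of_lt hj1 hx2
    exact_mod_cast this
  have hjpos : (0 : ℝ) < j := by
    have : 0 < j := by omega
    exact_mod_cast this
  have l1 : Real.logb 2 j ≤ u := by
    rw [hux]; exact Real.logb_le_logb_of_le (by norm_num) hjpos hj1
  have l2 : u ≤ Real.logb 2 (j + 1) := by
    rw [hux]; exact Real.logb_le_logb_of_le (by norm_num) hxpos hj2.le
  have k1 := key j (by omega) (by omega) z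
  have k2 := key (j + 1) (by omega) (by omega) z
  push_cast at k2
  rw [← hu] at k1 k2
  rw [abs_of_nonneg (by linarith)] at k1
  rw [abs_of_nonpos (by linarith)] at k2
  have := aux_gap n j hn hnj
  change sInf ((fun k => dist ((s : ℝ) : AddCircle (1 : ℝ)) (ySeq k)) '' Set.Icc 1 n) ≤ _
  linarith

theorem aux_no (n k : ℕ) (hk : k ∈ Set.Icc 1 n) (m : ℤ)
    (h1 : (n : ℝ) < (2 * (k : ℝ) - 1) * (2 : ℝ) ^ m)
    (h2 : (2 * (k : ℝ) - 1) * (2 : ℝ) ^ m < n + 1) : False := by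
  obtain ⟨hk1, hk2⟩ := hk
  have hk2' : (k : ℝ) ≤ n := by exact_mod_cast hk2
  have hk1' : (1 : ℝ) ≤ k := by exact_mod_cast hk1
  rcases le_or_gt 0 m with hm | hm
  · lift m to ℕ using hm
    rw [zpow_natCast] at h1 h2
    have h1' : (n : ℤ) < (2 * (k : ℤ) - 1) * 2 ^ m := by exact_mod_cast h1
    have h2' : (2 * (k : ℤ) - 1) * 2 ^ m < n + 1 := by exact_mod_cast h2
    omega
  · have : (2 : ℝ) ^ m ≤ 2 ^ (-1 : ℤ) := zpow_le_zpow_right₀ (by norm_num) (by omega)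
    norm_num at this
    nlinarith

theorem aux_lower (n : ℕ) (hn : 1 ≤ n) :
    (Real.logb 2 ((n : ℝ) + 1) - Real.logb 2 n) / 2 ≤
    sInf ((fun k => dist (((Real.logb 2 ((n : ℝ) + 1) + Real.logb 2 n) / 2 : ℝ) :
      AddCircle (1 : ℝ)) (ySeq k)) '' Set.Icc 1 n) := by
  have hn' : (1 : ℝ) ≤ n := by exact_mod_cast hn
  refine le_csInf ⟨_, 1, ⟨le_rfl, hn⟩, rfl⟩ ?_
  rintro _ ⟨k, hk, rfl⟩
  have hk1' : (1 : ℝ) ≤ k := by exact_mod_cast hk.1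
  simp only [ySeq]
  rw [dist_eq_norm, ← AddCircle.coe_sub]
  refine aux_norm_ge _ _ fun m => ?_
  by_contra! hlt
  rw [abs_lt] at hlt
  have hpos : 0 < (2 * (k : ℝ) - 1) * (2 : ℝ) ^ m := mul_pos (by linarith) (by positivity)
  have e : Real.logb 2 ((2 * (k : ℝ) - 1) * (2 : ℝ) ^ m) = Real.logb 2 (2 * (k : ℝ) - 1) + m := by
    rw [Real.logb_mul (by linarith) (by positivity), ← Real.rpow_intCast,
      Real.logb_rpow (by norm_num) (by norm_num)]
  refine aux_no n k hk m ?_ ?_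
  · rw [← Real.logb_lt_logb_iff (b := 2) (by norm_num) (by linarith) hpos, e]
    linarith
  · rw [← Real.logb_lt_logb_iff (b := 2) (by norm_num) hpos (by linarith), e]
    linarith

theorem aux_covRad (n : ℕ) (hn : 1 ≤ n) :
    covRad ySeq n = (Real.logb 2 ((n : ℝ) + 1) - Real.logb 2 n) / 2 := by
  refine le_antisymm (ciSup_le (aux_upper n hn)) ?_
  refine (aux_lower n hn).trans ?_
  refine le_ciSup (f := fun t : AddCircle (1 : ℝ) =>
    sInf ((fun k => dist t (ySeq k)) '' Set.Icc 1 n))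
    ⟨(Real.logb 2 ((n : ℝ) + 1) - Real.logb 2 n) / 2, ?_⟩ _
  rintro _ ⟨t, rfl⟩
  exact aux_upper n hn t

/-- For the sequence `y_k = log₂(2k − 1) (mod 1)`,
`lim_{n→∞} n·D_n(y) = 1/(2 ln 2)`. -/
theorem tendsto_mul_covRad_ySeq :
    Filter.Tendsto (fun n : ℕ => (n : ℝ) * covRad ySeq n) Filter.atTop
      (nhds (1 / (2 * Real.log 2))) := by
  have h := ((Real.tendsto_mul_log_one_add_div_atTop 1).comp
    (tendsto_natCast_atTop_atTop (R := ℝ))).div_const (2 * Real.log 2)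
  refine h.congr' ?_
  filter_upwards [Filter.eventually_ge_atTop 1] with n hn
  have hn' : (1 : ℝ) ≤ n := by exact_mod_cast hn
  rw [aux_covRad n hn, ← Real.logb_div (by linarith) (by linarith), Real.logb]
  have : ((n : ℝ) + 1) / n = 1 + 1 / n := by field_simp
  rw [this]
  have : Real.log 2 ≠ 0 := (Real.log_pos (by norm_num)).ne'
  simp only [Function.comp]
  field_simp
end

section
/- For the sequence y = (y_k)_{k≥1} in the unit circle 𝕋 = ℝ/ℤ given by y_k = log₂(2k − 1) (mod 1), the limit lim_{n→∞} n · d_n(y) exists and equals 1/(2 ln 2). -/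
lemma aux_log_sub {x y : ℝ} (hx : 0 < x) (hy : 0 < y) :
    (y - x) / y ≤ Real.log y - Real.log x := by
  have h := Real.log_le_sub_one_of_pos (div_pos hx hy)
  rw [Real.log_div hx.ne' hy.ne'] at h
  have : (y - x) / y = 1 - x / y := by field_simp
  linarith

lemma aux_key (a b n m : ℕ) (ha : Odd a) (hb : Odd b) (hab : a ≠ b)
    (han : a + 1 ≤ 2 * n) (hbn : b + 1 ≤ 2 * n) :
    1 / (2 * (n : ℝ)) ≤ |Real.log a - Real.log b - m * Real.log 2| := by
  have ha0 : 0 < a := ha.pos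
  have hb0 : 0 < b := hb.pos
  have hn0 : 0 < n := by omega
  have hne : a ≠ 2 ^ m * b := by
    intro h
    rcases Nat.eq_zero_or_pos m with rfl | hm
    · simp at h; exact hab h
    · have : Even (2 ^ m * b) := ((Nat.even_pow.2 ⟨even_two, hm.ne'⟩)).mul_right b
      rw [← h] at this
      exact (Nat.not_even_iff_odd.2 ha) this
  have haR : (0 : ℝ) < a := by exact_mod_cast ha0
  have hnR : (0 : ℝ) < n := by exact_mod_cast hn0
  have hcR : (0 : ℝ) < ((2 ^ m * b : ℕ) : ℝ) := by exact_mod_cast (by positivity)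
  have hlog : Real.log a - Real.log b - m * Real.log 2
      = Real.log a - Real.log ((2 ^ m * b : ℕ) : ℝ) := by
    have hbR : (b : ℝ) ≠ 0 := by exact_mod_cast hb0.ne'
    push_cast
    rw [Real.log_mul (by positivity) hbR, Real.log_pow]
    ring
  rw [hlog]
  have han' : (a : ℝ) + 1 ≤ 2 * n := by exact_mod_cast han
  generalize 2 ^ m * b = c at *
  rcases lt_or_gt_of_ne hne with h | h
  · have h1 : (a : ℝ) + 1 ≤ c := by exact_mod_cast h
    have h2 : Real.log ((a : ℝ) + 1) ≤ Real.log c := Real.log_le_log (by positivity) h1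
    have h3 := aux_log_sub haR (show (0 : ℝ) < a + 1 by positivity)
    have h4 : 1 / (2 * (n : ℝ)) ≤ (a + 1 - a) / ((a : ℝ) + 1) := by
      rw [add_sub_cancel_left]
      exact one_div_le_one_div_of_le (by positivity) han'
    rw [abs_sub_comm]
    exact le_trans (by linarith) (le_abs_self _)
  · have h1 : (c : ℝ) + 1 ≤ a := by exact_mod_cast h
    have h3 := aux_log_sub hcR haR
    have h4 : 1 / (2 * (n : ℝ)) ≤ (a - c) / (a : ℝ) := by
      apply div_le_div₀ <;> linarith
    exact le_trans (by linarith) (le_abs_self _)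

lemma aux_dist (r s : ℕ) : ∃ k : ℤ, dist (ySeq r) (ySeq s)
    = |Real.logb 2 (2 * (r : ℝ) - 1) - Real.logb 2 (2 * (s : ℝ) - 1) - k| := by
  refine ⟨round (Real.logb 2 (2 * (r : ℝ) - 1) - Real.logb 2 (2 * (s : ℝ) - 1)), ?_⟩
  rw [dist_eq_norm, ySeq, ySeq, ← AddCircle.coe_sub]
  exact UnitAddCircle.norm_eq

lemma aux_dist_le (r s : ℕ) (k : ℤ) : dist (ySeq r) (ySeq s)
    ≤ |Real.logb 2 (2 * (r : ℝ) - 1) - Real.logb 2 (2 * (s : ℝ) - 1) - k| := by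
  rw [dist_eq_norm, ySeq, ySeq, ← AddCircle.coe_sub]
  refine le_trans (le_of_eq UnitAddCircle.norm_eq) (round_le _ _)

lemma aux_lower_s7 (n r s : ℕ) (hr : 1 ≤ r) (hrs : r < s) (hs : s ≤ n) :
    1 / (2 * (n : ℝ)) / Real.log 2 ≤ dist (ySeq r) (ySeq s) := by
  obtain ⟨k, hk⟩ := aux_dist r s
  have hl : 0 < Real.log 2 := Real.log_pos (by norm_num)
  rw [hk, div_le_iff₀ hl]
  have hcr : (2 * (r : ℝ) - 1) = ((2 * r - 1 : ℕ) : ℝ) := by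
    rw [Nat.cast_sub (by omega)]; push_cast; ring
  have hcs : (2 * (s : ℝ) - 1) = ((2 * s - 1 : ℕ) : ℝ) := by
    rw [Nat.cast_sub (by omega)]; push_cast; ring
  have hor : Odd (2 * r - 1) := ⟨r - 1, by omega⟩
  have hos : Odd (2 * s - 1) := ⟨s - 1, by omega⟩
  have e : |Real.logb 2 (2 * (r : ℝ) - 1) - Real.logb 2 (2 * (s : ℝ) - 1) - k| * Real.log 2
      = |Real.log (2 * (r : ℝ) - 1) - Real.log (2 * (s : ℝ) - 1) - k * Real.log 2| := by
    conv_lhs => rw [← abs_of_pos hl, ← abs_mul]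
    congr 1
    simp only [Real.logb]
    field_simp
  rw [e, hcr, hcs]
  obtain ⟨m, rfl | rfl⟩ := Int.eq_nat_or_neg k
  · have := aux_key (2 * r - 1) (2 * s - 1) n m hor hos (by omega) (by omega) (by omega)
    simpa using this
  · have := aux_key (2 * s - 1) (2 * r - 1) n m hos hor (by omega) (by omega) (by omega)
    rw [← abs_neg]
    refine this.trans (le_of_eq ?_)
    congr 1
    push_cast
    ring

lemma aux_upper_s7 (n : ℕ) (hn : 2 ≤ n) : ∃ r : ℕ, 1 ≤ r ∧ r < n ∧
    dist (ySeq r) (ySeq n) ≤ 1 / (2 * (n : ℝ) - 1) / Real.log 2 := by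
  obtain ⟨m, b, hb, hnb⟩ := Nat.exists_eq_two_pow_mul_odd (n := n) (by omega)
  obtain ⟨q, hq⟩ := hb
  have hbn : b ≤ n := by
    rw [hnb]; exact Nat.le_mul_of_pos_left _ (by positivity)
  refine ⟨q + 1, by omega, by omega, ?_⟩
  refine (aux_dist_le (q + 1) n (-((m : ℤ) + 1))).trans ?_
  have hl : 0 < Real.log 2 := Real.log_pos (by norm_num)
  have hnR : (2 : ℝ) ≤ n := by exact_mod_cast hn
  have hqb : (2 * ((q + 1 : ℕ) : ℝ) - 1) = b := by rw [hq]; push_cast; ring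
  have hb0 : (b : ℝ) ≠ 0 := by
    have : b ≠ 0 := by omega
    exact_mod_cast this
  have h2n : Real.log (2 * (n : ℝ)) = Real.log b + (m + 1) * Real.log 2 := by
    have : (2 * (n : ℝ)) = 2 ^ (m + 1) * b := by
      rw [hnb]; push_cast; ring
    rw [this, Real.log_mul (by positivity) hb0, Real.log_pow]
    push_cast; ring
  have e : Real.logb 2 (2 * ((q + 1 : ℕ) : ℝ) - 1) - Real.logb 2 (2 * (n : ℝ) - 1)
      - ((-((m : ℤ) + 1) : ℤ) : ℝ)
      = (Real.log (2 * (n : ℝ)) - Real.log (2 * (n : ℝ) - 1)) / Real.log 2 := by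
    rw [hqb, h2n]
    simp only [Real.logb]
    push_cast
    field_simp
    ring
  have hp : (0 : ℝ) < 2 * n - 1 := by linarith
  have hmono : Real.log (2 * (n : ℝ) - 1) ≤ Real.log (2 * (n : ℝ)) :=
    Real.log_le_log hp (by linarith)
  rw [e, abs_of_nonneg (div_nonneg (by linarith) hl.le)]
  have h5 := aux_log_sub (x := 2 * (n : ℝ)) (y := 2 * (n : ℝ) - 1) (by linarith) hp
  have h6 : (2 * (n : ℝ) - 1 - 2 * n) / (2 * (n : ℝ) - 1) = -(1 / (2 * (n : ℝ) - 1)) := by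
    rw [← neg_div]; congr 1; ring
  rw [h6] at h5
  exact div_le_div_of_nonneg_right (by linarith) hl.le

/-- For the sequence `y_k = log₂(2k − 1) (mod 1)`,
`lim_{n→∞} n·d_n(y) = 1/(2 ln 2)`. -/
theorem tendsto_mul_minSep_ySeq :
    Filter.Tendsto (fun n : ℕ => (n : ℝ) * minSep ySeq n) Filter.atTop
      (nhds (1 / (2 * Real.log 2))) := by
  have hl : 0 < Real.log 2 := Real.log_pos (by norm_num)
  have hlim : Filter.Tendsto (fun n : ℕ => 1 / ((2 - 1 / (n : ℝ)) * Real.log 2)) Filter.atTop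
      (nhds (1 / (2 * Real.log 2))) := by
    have h0 := tendsto_one_div_atTop_nhds_zero_nat (𝕜 := ℝ)
    have h1 := ((h0.const_sub 2).mul_const (Real.log 2))
    rw [sub_zero] at h1
    exact tendsto_const_nhds.div h1 (by positivity)
  refine tendsto_of_tendsto_of_tendsto_of_le_of_le' tendsto_const_nhds hlim ?_ ?_
  · filter_upwards [Filter.eventually_ge_atTop 2] with n hn
    have hnR : (2 : ℝ) ≤ n := by exact_mod_cast hn
    have h : 1 / (2 * (n : ℝ)) / Real.log 2 ≤ minSep ySeq n := by
      refine le_csInf ⟨_, 1, 2, le_rfl, by norm_num, hn, rfl⟩ ?_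
      rintro d ⟨r, s, hr, hrs, hs, rfl⟩
      exact aux_lower_s7 n r s hr hrs hs
    calc 1 / (2 * Real.log 2) = n * (1 / (2 * (n : ℝ)) / Real.log 2) := by
          field_simp
      _ ≤ _ := by gcongr
  · filter_upwards [Filter.eventually_ge_atTop 2] with n hn
    have hnR : (2 : ℝ) ≤ n := by exact_mod_cast hn
    obtain ⟨r, hr, hrn, hd⟩ := aux_upper_s7 n hn
    have h : minSep ySeq n ≤ 1 / (2 * (n : ℝ) - 1) / Real.log 2 := by
      refine le_trans (csInf_le ⟨0, ?_⟩ ⟨r, n, hr, hrn, le_rfl, rfl⟩) hd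
      rintro d ⟨r, s, _, _, _, rfl⟩
      exact dist_nonneg
    have hp : (2 * (n : ℝ) - 1) ≠ 0 := by linarith
    calc _ ≤ n * (1 / (2 * (n : ℝ) - 1) / Real.log 2) := by gcongr
      _ = _ := by
        have : (2 - 1 / (n : ℝ)) = (2 * n - 1) / n := by field_simp
        rw [this]
        field_simp
end

section
/- Let x = (x_k)_{k≥1} be a sequence of pairwise distinct points of the unit circle 𝕋 = ℝ/ℤ, and for n ≥ 1 let t_{n,1} ≥ t_{n,2} ≥ … ≥ t_{n,n} be the gap lengths of the set x[n] = {x_1, …, x_n} in non-increasing order. Then for all n ≥ 1 and 1 ≤ k ≤ n, one has t_{n,k} ≤ t_{n+k−1,1}. -/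
/-- The length of the gap (open arc) of the finite set `S ⊂ 𝕋 = ℝ/ℤ` that starts at the
point `s`: the least `ℓ > 0` such that moving counterclockwise from `s` by `ℓ` lands in `S`.
For `s ∈ S` this is the length of the gap of `S` whose initial endpoint is `s`. -/
noncomputable def gapAt (S : Finset (AddCircle (1 : ℝ))) (s : AddCircle (1 : ℝ)) : ℝ :=
  sInf {ℓ : ℝ | 0 < ℓ ∧ s + ((ℓ : ℝ) : AddCircle (1 : ℝ)) ∈ S}

/-- The gap lengths of a finite set `S ⊂ 𝕋`, listed in non-increasing order
(each gap is recorded at its initial endpoint, so there are `S.card` of them,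
with multiplicity). -/
noncomputable def sortedGaps (S : Finset (AddCircle (1 : ℝ))) : List ℝ :=
  (S.val.map (gapAt S)).sort (· ≥ ·)

/-- `gapLen S k` is `t_k(S)`, the `k`-th largest gap length of `S` (1-indexed). -/
noncomputable def gapLen (S : Finset (AddCircle (1 : ℝ))) (k : ℕ) : ℝ :=
  (sortedGaps S).getD (k - 1) 0

theorem gapAt_le_aux (S : Finset (AddCircle (1 : ℝ))) (s : AddCircle (1 : ℝ)) (l : ℝ)
    (hl : 0 < l) (h : s + ((l : ℝ) : AddCircle (1 : ℝ)) ∈ S) : gapAt S s ≤ l :=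
  csInf_le ⟨0, fun _ hy => hy.1.le⟩ ⟨hl, h⟩

theorem exists_new_aux (S S' : Finset (AddCircle (1 : ℝ))) (s : AddCircle (1 : ℝ))
    (hs : s ∈ S') (h : gapAt S' s < gapAt S s) :
    ∃ l : ℝ, 0 < l ∧ l < gapAt S s ∧ s + ((l : ℝ) : AddCircle (1 : ℝ)) ∈ S' \ S := by
  obtain ⟨l, ⟨hl, hm⟩, hlt⟩ := exists_lt_of_csInf_lt
    (s := {l : ℝ | 0 < l ∧ s + ((l : ℝ) : AddCircle (1 : ℝ)) ∈ S'})
    ⟨1, one_pos, by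
      have : ((1 : ℝ) : AddCircle (1 : ℝ)) = 0 := AddCircle.coe_period 1
      rw [this, add_zero]; exact hs⟩ h
  refine ⟨l, hl, hlt, Finset.mem_sdiff.2 ⟨hm, fun hS => ?_⟩⟩
  exact absurd (gapAt_le_aux S s l hl hS) (not_le.2 hlt)

theorem inj_aux (S : Finset (AddCircle (1 : ℝ))) (s s' : AddCircle (1 : ℝ)) (hs : s ∈ S)
    (l l' : ℝ) (hl : 0 ≤ l) (hl' : l' < gapAt S s')
    (h : s + ((l : ℝ) : AddCircle (1 : ℝ)) = s' + ((l' : ℝ) : AddCircle (1 : ℝ))) :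
    l' ≤ l := by
  by_contra! hlt
  have h1 : s' + (((l' - l : ℝ)) : AddCircle (1 : ℝ)) = s := by
    rw [AddCircle.coe_sub, ← add_sub_assoc, ← h, add_sub_cancel_right]
  have h2 := gapAt_le_aux S s' (l' - l) (by linarith) (by rw [h1]; exact hs)
  linarith

theorem exists_good_aux (S S' A : Finset (AddCircle (1 : ℝ))) (hSS : S ⊆ S') (hA : A ⊆ S)
    (hc : (S' \ S).card < A.card) : ∃ s ∈ A, gapAt S s ≤ gapAt S' s := by
  by_contra! hcon
  choose! f hf0 hf1 hf2 using fun s (hs : s ∈ A) =>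
    exists_new_aux S S' s (hSS (hA hs)) (hcon s hs)
  refine absurd (Finset.card_le_card_of_injOn
    (fun s => s + ((f s : ℝ) : AddCircle (1 : ℝ))) hf2 ?_) (not_le.2 hc)
  intro s hs s' hs' h
  have h1 := inj_aux S s s' (hA hs) (f s) (f s') (hf0 s hs).le (hf1 s' hs') h
  have h2 := inj_aux S s' s (hA hs') (f s') (f s) (hf0 s' hs').le (hf1 s hs) h.symm
  have h3 : f s = f s' := le_antisymm h2 h1
  simp only [h3] at h
  exact add_right_cancel h

theorem le_gapLen_one_aux (S : Finset (AddCircle (1 : ℝ))) (s : AddCircle (1 : ℝ))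
    (hs : s ∈ S) : gapAt S s ≤ gapLen S 1 := by
  have hm : gapAt S s ∈ sortedGaps S := by
    unfold sortedGaps
    rw [Multiset.mem_sort]
    exact Multiset.mem_map_of_mem _ hs
  have hp : (sortedGaps S).Pairwise (· ≥ ·) := Multiset.pairwise_sort _ _
  unfold gapLen
  revert hm hp
  cases sortedGaps S with
  | nil => simp
  | cons a t =>
    intro hm hp
    simp only [le_refl, Nat.sub_self, List.getD_cons_zero]
    rcases List.mem_cons.1 hm with h | h
    · exact h.le
    · exact (List.pairwise_cons.1 hp).1 _ h

theorem card_aux (S : Finset (AddCircle (1 : ℝ))) (k : ℕ) (hk : 1 ≤ k) (hkS : k ≤ S.card) :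
    k ≤ (S.filter (fun s => gapLen S k ≤ gapAt S s)).card := by
  have hp : (sortedGaps S).Pairwise (· ≥ ·) := Multiset.pairwise_sort _ _
  have hlen : (sortedGaps S).length = S.card := by
    simp [sortedGaps]
  have h1 : (S.filter (fun s => gapLen S k ≤ gapAt S s)).card
      = (sortedGaps S).countP (fun r => decide (gapLen S k ≤ r)) := by
    have : ((sortedGaps S : List ℝ) : Multiset ℝ) = S.val.map (gapAt S) :=
      Multiset.sort_eq _ _
    rw [← Multiset.coe_countP, this, Multiset.countP_map]
    rfl
  rw [h1]
  have h2 : ((sortedGaps S).take k).countP (fun r => decide (gapLen S k ≤ r)) = k := by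
    have : ((sortedGaps S).take k).length = k := by
      rw [List.length_take, hlen]; omega
    conv_rhs => rw [← this]
    rw [List.countP_eq_length]
    intro a ha
    obtain ⟨i, hi, rfl⟩ := List.getElem_of_mem ha
    rw [this] at hi
    simp only [decide_eq_true_eq, List.getElem_take, gapLen]
    rw [List.getD_eq_getElem _ _ (by omega)]
    rcases Nat.lt_or_ge i (k - 1) with h | h
    · exact List.pairwise_iff_getElem.1 hp i (k - 1) (by omega) (by omega) h
    · have : i = k - 1 := by omega
      subst this; exact le_rfl
  calc k = _ := h2.symm
    _ ≤ _ := (List.take_sublist k _).countP_le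

/-- For a sequence `x` of pairwise distinct points of the unit circle, with
`t_{n,k}` the `k`-th largest gap length of `x[n] = {x_1, …, x_n}`, one has
`t_{n,k} ≤ t_{n+k−1,1}` for all `n ≥ 1` and `1 ≤ k ≤ n`. -/
theorem gapLen_le_gapLen_one (x : ℕ → AddCircle (1 : ℝ))
    (hx : ∀ i j : ℕ, 1 ≤ i → 1 ≤ j → i ≠ j → x i ≠ x j) :
    ∀ n k : ℕ, 1 ≤ k → k ≤ n →
      gapLen ((Finset.Icc 1 n).image x) k ≤ gapLen ((Finset.Icc 1 (n + k - 1)).image x) 1 := by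
  intro n k hk hkn
  set S := (Finset.Icc 1 n).image x with hS
  set S' := (Finset.Icc 1 (n + k - 1)).image x with hS'
  have hSS : S ⊆ S' := Finset.image_subset_image (Finset.Icc_subset_Icc le_rfl (by omega))
  have inj : ∀ m, Set.InjOn x (Finset.Icc 1 m : Finset ℕ) := by
    intro m i hi j hj h
    by_contra hne
    simp only [Finset.coe_Icc, Set.mem_Icc] at hi hj
    exact hx i j hi.1 hj.1 hne h
  have c1 : S.card = n := by rw [hS, Finset.card_image_of_injOn (inj n)]; simp
  have c2 : S'.card = n + k - 1 := by
    rw [hS', Finset.card_image_of_injOn (inj (n + k - 1))]; simp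
  have c3 : (S' \ S).card = k - 1 := by
    rw [Finset.card_sdiff_of_subset hSS, c1, c2]; omega
  have hA := card_aux S k hk (by omega)
  obtain ⟨s, hs, hle⟩ := exists_good_aux S S' _ hSS (Finset.filter_subset _ _)
    (show (S' \ S).card < (S.filter (fun s => gapLen S k ≤ gapAt S s)).card by omega)
  rw [Finset.mem_filter] at hs
  exact hs.2.trans (hle.trans (le_gapLen_one_aux S' s (hSS hs.1)))
end

section
/- Let x = (x_k)_{k≥1} be a sequence of pairwise distinct points of the unit circle 𝕋 = ℝ/ℤ, and for m ≥ 1 let t_{m,1} ≥ t_{m,2} ≥ … ≥ t_{m,m} be the gap lengths of the set x[m] = {x_1, …, x_m} in non-increasing order. Then for all n ≥ 1 and 1 ≤ k ≤ n, one has t_{2n,2k} ≥ t_{n+k,n+k}. -/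
theorem gapAt_isLeast (S : Finset (AddCircle (1 : ℝ))) (s : AddCircle (1 : ℝ)) (hs : s ∈ S) :
    IsLeast {ℓ : ℝ | 0 < ℓ ∧ s + ((ℓ : ℝ) : AddCircle (1 : ℝ)) ∈ S} (gapAt S s) := by
  set T := {ℓ : ℝ | 0 < ℓ ∧ s + ((ℓ : ℝ) : AddCircle (1 : ℝ)) ∈ S} with hT
  have hfin : (T ∩ Set.Ioc 0 1).Finite := by
    apply Set.Finite.of_finite_image (f := fun ℓ : ℝ => s + ((ℓ : ℝ) : AddCircle (1 : ℝ)))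
    · apply S.finite_toSet.subset
      rintro _ ⟨ℓ, hℓ, rfl⟩
      exact hℓ.1.2
    · intro a ha b hb hab
      have h : ((a : ℝ) : AddCircle (1 : ℝ)) = (b : ℝ) := add_left_cancel hab
      have : Fact ((0:ℝ) < 1) := ⟨one_pos⟩
      have ha' : a ∈ Set.Ioc (0:ℝ) (0 + 1) := by simpa using ha.2
      have hb' : b ∈ Set.Ioc (0:ℝ) (0 + 1) := by simpa using hb.2
      exact (AddCircle.coe_eq_coe_iff_of_mem_Ioc ha' hb').1 h
  have h1 : (1 : ℝ) ∈ T ∩ Set.Ioc 0 1 := by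
    refine ⟨⟨one_pos, ?_⟩, by norm_num⟩
    rw [AddCircle.coe_period]; simpa using hs
  obtain ⟨m, hm, hmin⟩ := Set.exists_min_image _ id hfin ⟨1, h1⟩
  have hl : IsLeast T m := by
    refine ⟨hm.1, fun b hb => ?_⟩
    by_cases hb1 : b ≤ 1
    · exact hmin b ⟨hb, hb.1, hb1⟩
    · exact hm.2.2.trans (not_le.1 hb1).le
  have : gapAt S s = m := hl.csInf_eq
  rw [this]; exact hl

theorem sorted_getD_ge (l : List ℝ) (hl : l.Pairwise (· ≥ ·)) (d : ℝ) (i : ℕ)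
    (hi : i < (l.filter (fun a => decide (d ≤ a))).length) : d ≤ l.getD i 0 := by
  induction l generalizing i with
  | nil => simp at hi
  | cons a l ih =>
    rw [List.pairwise_cons] at hl
    by_cases h : d ≤ a
    · cases i with
      | zero => simpa using h
      | succ i =>
        simp only [List.getD_cons_succ]
        apply ih hl.2
        simpa [List.filter_cons, h] using hi
    · exfalso
      have : (List.filter (fun a => decide (d ≤ a)) (a :: l)) = [] := by
        rw [List.filter_eq_nil_iff]
        intro b hb
        rcases List.mem_cons.1 hb with rfl | hb
        · simpa using h
        · have := hl.1 b hb
          simp; linarith [not_le.1 h]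
      rw [this] at hi
      simp at hi

theorem sorted_last_le (l : List ℝ) (hl : l.Pairwise (· ≥ ·)) (a : ℝ) (ha : a ∈ l) :
    l.getD (l.length - 1) 0 ≤ a := by
  obtain ⟨i, hi, rfl⟩ := List.getElem_of_mem ha
  rw [List.getD_eq_getElem _ _ (by omega)]
  rcases Nat.lt_or_ge i (l.length - 1) with h | h
  · exact List.pairwise_iff_getElem.1 hl _ _ _ _ h
  · have : i = l.length - 1 := by omega
    subst this; exact le_rfl

theorem card_broken_le (A B : Finset (AddCircle (1 : ℝ))) (hAB : A ⊆ B) :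
    (A.filter (fun s => gapAt B s < gapAt A s)).card ≤ (B \ A).card := by
  have key : ∀ s ∈ A, ∀ s' ∈ A, gapAt B s ≤ gapAt B s' →
      s + ((gapAt B s : ℝ) : AddCircle (1 : ℝ)) = s' + ((gapAt B s' : ℝ) : AddCircle (1 : ℝ)) →
      s = s' := by
    intro s hs s' hs' hle heq
    have hs1 : s = s' + ((gapAt B s' - gapAt B s : ℝ) : AddCircle (1 : ℝ)) := by
      rw [AddCircle.coe_sub, ← add_sub_assoc, ← heq]; simp
    rcases hle.lt_or_eq with h | h
    · have h2 : gapAt B s' ≤ gapAt B s' - gapAt B s := (gapAt_isLeast B s' (hAB hs')).2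
        ⟨by linarith, by rw [← hs1]; exact hAB hs⟩
      have h3 := (gapAt_isLeast B s (hAB hs)).1.1
      linarith
    · rw [h] at hs1; simpa using hs1
  apply Finset.card_le_card_of_injOn
    (fun s => s + ((gapAt B s : ℝ) : AddCircle (1 : ℝ)))
  · intro s hs
    have hs := Finset.mem_filter.1 hs
    have h1 := (gapAt_isLeast B s (hAB hs.1)).1
    refine Finset.mem_coe.2 (Finset.mem_sdiff.2 ⟨h1.2, fun hA => ?_⟩)
    have : gapAt A s ≤ gapAt B s := (gapAt_isLeast A s hs.1).2 ⟨h1.1, hA⟩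
    linarith [hs.2]
  · intro s hs s' hs' heq
    have hs := (Finset.mem_filter.1 hs).1
    have hs' := (Finset.mem_filter.1 hs').1
    rcases le_total (gapAt B s) (gapAt B s') with h | h
    · exact key s hs s' hs' h heq
    · exact (key s' hs' s hs h heq.symm).symm

theorem gapLen_two_n_two_k_ge (x : ℕ → AddCircle (1 : ℝ))
    (hx : ∀ i j : ℕ, 1 ≤ i → 1 ≤ j → i ≠ j → x i ≠ x j) :
    ∀ n k : ℕ, 1 ≤ n → 1 ≤ k → k ≤ n →
      gapLen ((Finset.Icc 1 (n + k)).image x) (n + k) ≤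
        gapLen ((Finset.Icc 1 (2 * n)).image x) (2 * k) := by
  intro n k hn hk hkn
  have hcard : ∀ m : ℕ, ((Finset.Icc 1 m).image x).card = m := by
    intro m
    rw [Finset.card_image_of_injOn]
    · simp
    · intro i hi j hj hij
      by_contra hne
      exact hx i j (Finset.mem_Icc.1 hi).1 (Finset.mem_Icc.1 hj).1 hne hij
  have hAB : (Finset.Icc 1 (n + k)).image x ⊆ (Finset.Icc 1 (2 * n)).image x :=
    Finset.image_subset_image (Finset.Icc_subset_Icc le_rfl (by omega))
  have hA := hcard (n + k)
  have hB := hcard (2 * n)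
  generalize (Finset.Icc 1 (n + k)).image x = A at *
  generalize (Finset.Icc 1 (2 * n)).image x = B at *
  set d := gapLen A (n + k) with hd
  have hmin : ∀ s ∈ A, d ≤ gapAt A s := by
    intro s hs
    have hlen : (sortedGaps A).length = n + k := by
      simp [sortedGaps, hA]
    rw [hd, gapLen, ← hlen]
    apply sorted_last_le
    · exact Multiset.pairwise_sort _ _
    · simp only [sortedGaps, Multiset.mem_sort]
      exact Multiset.mem_map_of_mem _ hs
  have hbr := card_broken_le A B hAB
  have hsd : (B \ A).card = n - k := by
    rw [Finset.card_sdiff_of_subset hAB]; omega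
  have hsplit := Finset.card_filter_add_card_filter_not (s := A)
    (fun s => gapAt B s < gapAt A s)
  have hsub : A.filter (fun s => ¬ gapAt B s < gapAt A s) ⊆ B.filter (fun s => d ≤ gapAt B s) := by
    intro s hs
    have hs := Finset.mem_filter.1 hs
    exact Finset.mem_filter.2 ⟨hAB hs.1, (hmin s hs.1).trans (not_lt.1 hs.2)⟩
  have hc := Finset.card_le_card hsub
  have hfl : ((sortedGaps B).filter (fun a => decide (d ≤ a))).length =
      (B.filter (fun s => d ≤ gapAt B s)).card := by
    rw [← List.countP_eq_length_filter, ← Multiset.coe_countP, sortedGaps, Multiset.sort_eq,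
      Multiset.countP_map]
    rfl
  rw [gapLen]
  apply sorted_getD_ge
  · exact Multiset.pairwise_sort _ _
  · rw [hfl]; omega
end
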